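/- arXiv:1902.10605 — 4 statements merged into one kernel-verified Lean document; each statement's English description precedes it below -/
import Mathlib

section
/- For any symmetric n×n matrices Θ and Θ' with entries in (0,1) and any symmetric n×n matrix Π with entries in [0,1], one has ‖Θ − Θ'‖²_{2,Π} ≤ 8·max(‖Θ‖_∞, ‖Θ'‖_∞)·K_Π(Θ, Θ'). -/
noncomputable section

/-- Kullback–Leibler divergence between Bernoulli(q) and Bernoulli(q'). -/
def klBer (q q' : ℝ) : ℝ :=
  q * Real.log (q / q') + (1 - q) * Real.log ((1 - q) / (1 - q'))

/-- Sum of `f i j` over pairs `i < j`. -/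
def pairSum {n : ℕ} (f : Fin n → Fin n → ℝ) : ℝ :=
  ∑ i : Fin n, ∑ j : Fin n, if i < j then f i j else 0

/-- Weighted squared Frobenius-type norm `‖M‖_{2,B}²`. -/
def wNormSq {n : ℕ} (B M : Fin n → Fin n → ℝ) : ℝ :=
  pairSum fun i j => B i j * M i j ^ 2

/-- Weighted Kullback–Leibler divergence `K_B(M, M')`. -/
def wKL {n : ℕ} (B M M' : Fin n → Fin n → ℝ) : ℝ :=
  pairSum fun i j => B i j * klBer (M i j) (M' i j)

/-- Entrywise supremum norm `‖M‖_∞`. -/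
def supNorm {n : ℕ} (M : Fin n → Fin n → ℝ) : ℝ :=
  ⨆ i, ⨆ j, |M i j|

lemma aux_log (q p : ℝ) (hq : 0 < q) (hp : 0 < p) :
    2 * q - 2 * (√q * √p) ≤ q * Real.log (q / p) := by
  have ha := Real.sqrt_pos.2 hq
  have hb := Real.sqrt_pos.2 hp
  have h1 : Real.log (q / p) = -2 * Real.log (√p / √q) := by
    rw [Real.log_div hq.ne' hp.ne', Real.log_div hb.ne' ha.ne', Real.log_sqrt hp.le,
      Real.log_sqrt hq.le]
    ring
  have h2 := Real.log_le_sub_one_of_pos (div_pos hb ha)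
  have h3 : q * (√p / √q) = √q * √p := by
    have := Real.mul_self_sqrt hq.le
    field_simp
    nlinarith
  rw [h1]
  nlinarith [mul_le_mul_of_nonneg_left h2 hq.le]

lemma aux_kl (q p : ℝ) (hq : q ∈ Set.Ioo (0 : ℝ) 1) (hp : p ∈ Set.Ioo (0 : ℝ) 1) :
    (√q - √p) ^ 2 ≤ klBer q p := by
  obtain ⟨hq0, hq1⟩ := hq
  obtain ⟨hp0, hp1⟩ := hp
  have h1 := aux_log q p hq0 hp0
  have h2 := aux_log (1 - q) (1 - p) (by linarith) (by linarith)
  have e1 := Real.sq_sqrt hq0.le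
  have e2 := Real.sq_sqrt hp0.le
  have e3 := Real.sq_sqrt (show 0 ≤ 1 - q by linarith)
  have e4 := Real.sq_sqrt (show 0 ≤ 1 - p by linarith)
  unfold klBer
  nlinarith [sq_nonneg (√(1 - q) - √(1 - p))]

lemma aux_scalar (q p m : ℝ) (hq : q ∈ Set.Ioo (0 : ℝ) 1) (hp : p ∈ Set.Ioo (0 : ℝ) 1)
    (hqm : q ≤ m) (hpm : p ≤ m) : (q - p) ^ 2 ≤ 8 * m * klBer q p := by
  have h := aux_kl q p hq hp
  have e1 := Real.sq_sqrt hq.1.le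
  have e2 := Real.sq_sqrt hp.1.le
  have e : (q - p) ^ 2 = (√q + √p) ^ 2 * (√q - √p) ^ 2 := by
    rw [← mul_pow, ← e1, ← e2]; simp [Real.sqrt_sq]; ring
  have hm : (√q + √p) ^ 2 ≤ 8 * m := by
    nlinarith [sq_nonneg (√q - √p), hq.1]
  rw [e]
  exact mul_le_mul hm h (sq_nonneg _) (by linarith [hq.1])

lemma le_supNorm {n : ℕ} (M : Fin n → Fin n → ℝ) (i j : Fin n) : M i j ≤ supNorm M :=
  (le_abs_self _).trans <|
    (le_ciSup (f := fun j => |M i j|) (Set.finite_range _).bddAbove j).trans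
      (le_ciSup (f := fun i => ⨆ j, |M i j|) (Set.finite_range _).bddAbove i)

theorem stmt_1 (n : ℕ) (Θ Θ' Pmat : Fin n → Fin n → ℝ)
    (hΘsym : ∀ i j, Θ i j = Θ j i) (hΘ'sym : ∀ i j, Θ' i j = Θ' j i)
    (hPmatsym : ∀ i j, Pmat i j = Pmat j i)
    (hΘ : ∀ i j, Θ i j ∈ Set.Ioo (0 : ℝ) 1) (hΘ' : ∀ i j, Θ' i j ∈ Set.Ioo (0 : ℝ) 1)
    (hPmat : ∀ i j, Pmat i j ∈ Set.Icc (0 : ℝ) 1) :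
    wNormSq Pmat (fun i j => Θ i j - Θ' i j) ≤
      8 * max (supNorm Θ) (supNorm Θ') * wKL Pmat Θ Θ' := by
  unfold wNormSq wKL pairSum
  rw [Finset.mul_sum]
  refine Finset.sum_le_sum fun i _ => ?_
  rw [Finset.mul_sum]
  refine Finset.sum_le_sum fun j _ => ?_
  split_ifs
  · have h := aux_scalar _ _ (max (supNorm Θ) (supNorm Θ')) (hΘ i j) (hΘ' i j)
      ((le_supNorm Θ i j).trans (le_max_left _ _)) ((le_supNorm Θ' i j).trans (le_max_right _ _))
    have := mul_le_mul_of_nonneg_left h (hPmat i j).1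
    linarith
  · simp
end
end

section
/- Let 0 < γ_n ≤ 1/2, let Π be a symmetric n×n matrix with entries in [0,1], let Θ* be a symmetric n×n matrix with zero diagonal and entries in [0,1], and let Θ̃ be a symmetric n×n matrix with zero diagonal and entries in [0,1). Define Θ̃^s entrywise by Θ̃^s_{ij} = max(Θ̃_{ij}, γ_n) for i < j (zero diagonal), and let n_s = #{(i,j) : i < j, Θ̃_{ij} < γ_n}. Then K_Π(Θ*, Θ̃^s) ≤ K_Π(Θ*, Θ̃) + 2·γ_n·n_s, where the inequality is interpreted in the extended reals. -/
noncomputable section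

/-- Extended-real-valued Bernoulli Kullback–Leibler divergence: for q' ∈ {0,1}, it is `+∞`
unless `q = q'` (and `K(0,0) = K(1,1) = 0`). -/
def klBerE (q q' : ℝ) : EReal :=
  if q' = 0 ∨ q' = 1 then (if q = q' then 0 else ⊤) else ((klBer q q' : ℝ) : EReal)

/-- Weighted Kullback–Leibler divergence `K_B(M, M')` with values in the extended reals. -/
def wKLE {n : ℕ} (B M M' : Fin n → Fin n → ℝ) : EReal :=
  ∑ i : Fin n, ∑ j : Fin n,
    if i < j then ((B i j : ℝ) : EReal) * klBerE (M i j) (M' i j) else 0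

theorem aux_coe_sum {ι : Type} (s : Finset ι) (f : ι → ℝ) :
    ((∑ i ∈ s, f i : ℝ) : EReal) = ∑ i ∈ s, (f i : EReal) :=
  map_sum (⟨⟨fun x : ℝ => (x : EReal), EReal.coe_zero⟩, EReal.coe_add⟩ : ℝ →+ EReal) f s

theorem aux_log_s2 (γ : ℝ) (hγ0 : 0 < γ) (hγ : γ ≤ 1 / 2) : -Real.log (1 - γ) ≤ 2 * γ := by
  have h1 : (0:ℝ) < 1 - γ := by linarith
  have h := Real.one_sub_inv_le_log_of_pos h1
  have h2 : (1 - γ)⁻¹ ≤ 1 + 2 * γ := by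
    rw [inv_le_iff_one_le_mul₀ h1]
    nlinarith
  linarith

theorem aux_real (γ q t : ℝ) (hγ0 : 0 < γ) (hγ : γ ≤ 1 / 2) (hq0 : 0 ≤ q) (hq1 : q ≤ 1)
    (ht0 : 0 ≤ t) (ht : t < γ) (h : t = 0 → q = 0) :
    klBer q γ ≤ klBer q t + 2 * γ := by
  have hl := aux_log_s2 γ hγ0 hγ
  have hlt : Real.log (1 - t) ≤ 0 := Real.log_nonpos (by linarith) (by linarith)
  have ha : q * Real.log (q / γ) ≤ q * Real.log (q / t) := by
    rcases eq_or_lt_of_le hq0 with h0 | h0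
    · simp [← h0]
    · have htp : 0 < t := lt_of_le_of_ne ht0 (fun e => h0.ne' (h e.symm))
      apply mul_le_mul_of_nonneg_left _ hq0
      apply Real.log_le_log (by positivity)
      gcongr
  have hb : (1 - q) * Real.log ((1 - q) / (1 - γ)) ≤
      (1 - q) * Real.log ((1 - q) / (1 - t)) + 2 * γ := by
    rcases eq_or_lt_of_le hq1 with h0 | h0
    · subst h0
      simp; linarith
    · rw [Real.log_div (by linarith) (by linarith), Real.log_div (by linarith) (by linarith)]
      have h3 : (1 - q) * (-Real.log (1 - γ)) ≤ (1 - q) * (2 * γ) :=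
        mul_le_mul_of_nonneg_left hl (by linarith)
      have h4 : 0 ≤ (1 - q) * (-Real.log (1 - t)) := mul_nonneg (by linarith) (by linarith)
      nlinarith [mul_nonneg hq0 hγ0.le]
  unfold klBer
  linarith

theorem aux_E (γ p q t : ℝ) (hγ0 : 0 < γ) (hγ : γ ≤ 1 / 2) (hp0 : 0 ≤ p) (hp1 : p ≤ 1)
    (hq0 : 0 ≤ q) (hq1 : q ≤ 1) (ht0 : 0 ≤ t) (ht : t < 1) :
    (p : EReal) * klBerE q (max t γ) ≤ (p : EReal) * klBerE q t +
      ((if t < γ then 2 * γ else 0 : ℝ) : EReal) := by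
  by_cases htg : t < γ
  · rw [max_eq_right htg.le, if_pos htg]
    have hg : klBerE q γ = ((klBer q γ : ℝ) : EReal) := by
      unfold klBerE
      rw [if_neg]
      rintro (h | h) <;> linarith
    rw [hg]
    by_cases hbad : t = 0 ∧ q ≠ 0
    · obtain ⟨rfl, hq⟩ := hbad
      have ht' : klBerE q 0 = ⊤ := by simp [klBerE, hq]
      rw [ht']
      rcases eq_or_lt_of_le hp0 with h0 | h0
      · rw [← h0]
        simp only [EReal.coe_zero, zero_mul, zero_add]
        exact_mod_cast (by linarith : (0:ℝ) ≤ 2 * γ)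
      · rw [EReal.coe_mul_top_of_pos h0, EReal.top_add_coe]
        exact le_top
    · have hgood : t = 0 → q = 0 := fun h => by
        by_contra hq
        exact hbad ⟨h, hq⟩
      have ht' : klBerE q t = ((klBer q t : ℝ) : EReal) := by
        unfold klBerE
        by_cases h : t = 0
        · have := hgood h
          subst h this
          simp [klBer]
        · rw [if_neg]
          rintro (h' | h')
          · exact h h'
          · linarith
      rw [ht']
      have := aux_real γ q t hγ0 hγ hq0 hq1 ht0 htg hgood
      have h5 : p * klBer q γ ≤ p * klBer q t + 2 * γ := by
        have := mul_le_mul_of_nonneg_left this hp0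
        nlinarith
      exact_mod_cast h5
  · rw [max_eq_left (not_lt.mp htg), if_neg htg]
    simp

theorem stmt_2 (n : ℕ) (γ : ℝ) (hγ0 : 0 < γ) (hγ : γ ≤ 1 / 2)
    (Pmat Θstar Θtil : Fin n → Fin n → ℝ)
    (hPsym : ∀ i j, Pmat i j = Pmat j i) (hP : ∀ i j, Pmat i j ∈ Set.Icc (0 : ℝ) 1)
    (hΘssym : ∀ i j, Θstar i j = Θstar j i) (hΘsdiag : ∀ i, Θstar i i = 0)
    (hΘs : ∀ i j, Θstar i j ∈ Set.Icc (0 : ℝ) 1)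
    (hΘtsym : ∀ i j, Θtil i j = Θtil j i) (hΘtdiag : ∀ i, Θtil i i = 0)
    (hΘt : ∀ i j, Θtil i j ∈ Set.Ico (0 : ℝ) 1) :
    wKLE Pmat Θstar (fun i j => if i = j then 0 else max (Θtil i j) γ) ≤
      wKLE Pmat Θstar Θtil +
        (((2 * γ * ((Finset.univ.filter
            (fun p : Fin n × Fin n => p.1 < p.2 ∧ Θtil p.1 p.2 < γ)).card : ℝ)) : ℝ) : EReal) := by
  have hcard : (((2 * γ * ((Finset.univ.filter
            (fun p : Fin n × Fin n => p.1 < p.2 ∧ Θtil p.1 p.2 < γ)).card : ℝ)) : ℝ) : EReal) =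
      ∑ i : Fin n, ∑ j : Fin n,
        (((if i < j then (if Θtil i j < γ then 2 * γ else 0) else 0 : ℝ)) : EReal) := by
    have : (2 * γ * ((Finset.univ.filter
            (fun p : Fin n × Fin n => p.1 < p.2 ∧ Θtil p.1 p.2 < γ)).card : ℝ)) =
        ∑ i : Fin n, ∑ j : Fin n,
          (if i < j then (if Θtil i j < γ then 2 * γ else 0) else 0 : ℝ) := by
      rw [← Fintype.sum_prod_type'
        (f := fun i j => (if i < j then (if Θtil i j < γ then 2 * γ else 0) else 0 : ℝ))]
      simp only [← ite_and]
      rw [← Finset.sum_filter, Finset.sum_const, nsmul_eq_mul, mul_comm]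
    rw [this, aux_coe_sum]
    simp only [aux_coe_sum]
  rw [hcard]
  unfold wKLE
  rw [← Finset.sum_add_distrib]
  apply Finset.sum_le_sum
  intro i _
  rw [← Finset.sum_add_distrib]
  apply Finset.sum_le_sum
  intro j _
  by_cases hij : i < j
  · simp only [if_pos hij, if_neg hij.ne]
    exact aux_E γ _ _ _ hγ0 hγ (hP i j).1 (hP i j).2 (hΘs i j).1 (hΘs i j).2 (hΘt i j).1 (hΘt i j).2
  · simp [hij]
end
end

section
/- Assume additionally γ_n ≤ 1 − ρ_n. There exist absolute constants c₀, C > 0 such that, setting ε⁰ = c₀·ρ_n·(ρ_n²/γ_n²)·(n·log k + k²), for every T ≥ 2·ε⁰, the random variable Z_T = sup_{Θ ∈ S_Π(T)} | ‖Θ − Θ̃‖²_{2,Π} − ‖Θ − Θ̃‖²_{2,X} |, where S_Π(T) = {Θ ∈ T_k : ‖Θ‖_∞ ≤ ρ_n, Θ_{ij} ≥ γ_n for all i < j, ‖Θ − Θ̃‖²_{2,Π} ≤ T}, satisfies P( Z_T ≥ T/4 ) ≤ exp(−C·T/ρ_n). -/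
open MeasureTheory ProbabilityTheory

noncomputable section

/-- `M ∈ T_k`: symmetric block-constant matrix with zero diagonal, built from a symmetric
`k × k` matrix `Q` and a label function `z : [n] → [k]`. -/
def IsBlockConst (n k : ℕ) (M : Fin n → Fin n → ℝ) : Prop :=
  (∀ i, M i i = 0) ∧
  ∃ (z : Fin n → Fin k) (Q : Fin k → Fin k → ℝ),
    (∀ a b, Q a b = Q b a) ∧ ∀ i j, i ≠ j → M i j = Q (z i) (z j)

/-- A symmetric zero-diagonal random matrix whose above-diagonal entries are independent
Bernoulli random variables, `A_{ij} ~ Bernoulli(P_{ij})` for `i < j`. -/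
def IsBernoulliMatrix {Ω : Type} [MeasurableSpace Ω] (μ : Measure Ω) {n : ℕ}
    (A : Ω → Fin n → Fin n → ℝ) (P : Fin n → Fin n → ℝ) : Prop :=
  (∀ i j, Measurable fun ω => A ω i j) ∧
  (∀ ω i j, A ω i j = A ω j i) ∧
  (∀ ω i, A ω i i = 0) ∧
  (∀ ω i j, A ω i j = 0 ∨ A ω i j = 1) ∧
  (∀ i j, i < j → μ {ω | A ω i j = 1} = ENNReal.ofReal (P i j)) ∧
  iIndepFun
    (fun (p : {p : Fin n × Fin n // p.1 < p.2}) ω => A ω p.1.1 p.1.2) μ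

/-- The random variable `Z_T = sup_{Θ ∈ S_Π(T)} | ‖Θ-Θ̃‖²_{2,Π} - ‖Θ-Θ̃‖²_{2,X} |`. -/
def ZT {Ω : Type} (n k : ℕ) (γ ρ T : ℝ) (Pmat Θtil : Fin n → Fin n → ℝ)
    (X : Ω → Fin n → Fin n → ℝ) (ω : Ω) : ℝ :=
  ⨆ Θ : {Θ : Fin n → Fin n → ℝ // IsBlockConst n k Θ ∧ supNorm Θ ≤ ρ ∧
      (∀ i j : Fin n, i < j → γ ≤ Θ i j) ∧
      wNormSq Pmat (fun i j => Θ i j - Θtil i j) ≤ T},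
    |wNormSq Pmat (fun i j => Θ.1 i j - Θtil i j) -
      wNormSq (X ω) (fun i j => Θ.1 i j - Θtil i j)|

lemma aux_gauss : ∃ K : ℝ, 0 < K ∧ ∀ (y : ℝ) (N : ℕ),
    ∑ m ∈ Finset.range N, Real.exp (-(1/4096) * ((m : ℝ) - y) ^ 2) ≤ K := by
  have hs1 : Summable (fun j : ℕ => Real.exp (-(1/8192) * (j : ℝ))) := by
    simpa using Real.summable_pow_mul_exp_neg_nat_mul 0 (r := 1/8192) (by norm_num)
  have hs : Summable (fun j : ℤ => Real.exp (-(1/8192) * |(j : ℝ)|)) := by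
    apply Summable.of_nat_of_neg
    · simpa using hs1
    · simpa using hs1
  have hpos : 0 < ∑' j : ℤ, Real.exp (-(1/8192) * |(j : ℝ)|) :=
    hs.tsum_pos (fun _ => (Real.exp_pos _).le) 0 (Real.exp_pos _)
  refine ⟨Real.exp 1 * ∑' j : ℤ, Real.exp (-(1/8192) * |(j : ℝ)|),
    mul_pos (Real.exp_pos _) hpos, ?_⟩
  intro y N
  have h1 : ∀ m : ℕ, Real.exp (-(1/4096) * ((m : ℝ) - y) ^ 2) ≤
      Real.exp 1 * Real.exp (-(1/8192) * |(((m : ℤ) - round y : ℤ) : ℝ)|) := by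
    intro m
    rw [← Real.exp_add]
    apply Real.exp_le_exp.mpr
    have hr := abs_sub_round y
    have hj : |(((m : ℤ) - round y : ℤ) : ℝ)| ≤ (((m : ℤ) - round y : ℤ) : ℝ) ^ 2 := by
      have : |((m : ℤ) - round y)| ≤ ((m : ℤ) - round y) ^ 2 := by
        rw [Int.abs_eq_natAbs, ← Int.natAbs_sq]
        exact_mod_cast Nat.le_self_pow two_ne_zero _
      exact_mod_cast this
    have hr2 : (y - round y) ^ 2 ≤ 1 / 4 := by
      have := sq_le_sq' (abs_le.mp hr).1 (abs_le.mp hr).2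
      linarith
    push_cast at hj ⊢
    nlinarith [sq_nonneg ((m : ℝ) - y - (y - round y))]
  calc _ ≤ ∑ m ∈ Finset.range N,
        Real.exp 1 * Real.exp (-(1/8192) * |(((m : ℤ) - round y : ℤ) : ℝ)|) :=
        Finset.sum_le_sum fun m _ => h1 m
    _ = Real.exp 1 * ∑ m ∈ Finset.range N,
        Real.exp (-(1/8192) * |(((m : ℤ) - round y : ℤ) : ℝ)|) := by rw [Finset.mul_sum]
    _ ≤ _ := by
        apply mul_le_mul_of_nonneg_left _ (Real.exp_pos _).le
        have hinj : Function.Injective (fun m : ℕ => (m : ℤ) - round y) := by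
          intro a b h
          simpa using h
        have := Finset.sum_image (s := Finset.range N) (g := fun m : ℕ => (m : ℤ) - round y)
          (f := fun j : ℤ => Real.exp (-(1/8192) * |(j : ℝ)|)) hinj.injOn
        rw [← this]
        exact hs.sum_le_tsum _ (fun _ _ => (Real.exp_pos _).le)

/-- linear exponents -/
def eU (σ : ℝ) (N : ℕ) (τ : ℝ) : Option ℕ → ℝ
  | none => 1 / 32 / (N : ℝ) ^ 2
  | some m => -(1 / 32) * σ * ((m : ℝ) / N - τ) ^ 2

def eV (σ : ℝ) (N : ℕ) (τ q : ℝ) : Option ℕ → ℝ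
  | none => 1 / 16 / (N : ℝ) ^ 2 * q
  | some m => (1 / 32) * (σ - 1 / 16) * q * ((m : ℝ) / N - τ) ^ 2

lemma aux_block {ι : Type*} (B : Finset ι) (q x τ : ι → ℝ) (hq : ∀ p, 0 ≤ q p)
    (hx : ∀ p, 0 ≤ x p) (σ : ℝ) (hσ : |σ| ≤ 1) (N : ℕ) (hN : 1 ≤ N) (t : ℝ)
    (ht0 : 0 ≤ t) (ht1 : t ≤ 1) :
    Real.exp (1 / 64 * ∑ p ∈ B, (σ * (q p - x p) - q p / 16) * (t - τ p) ^ 2) ≤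
      ∑ o ∈ Finset.insertNone (Finset.range (N + 1)),
        Real.exp (∑ p ∈ B, (eU σ N (τ p) o * x p + eV σ N (τ p) (q p) o)) := by
  set F : Option ℕ → ℝ := fun o => ∑ p ∈ B, (eU σ N (τ p) o * x p + eV σ N (τ p) (q p) o) with hF
  have hNr : (1 : ℝ) ≤ N := by exact_mod_cast hN
  have hN0 : (N : ℝ) ≠ 0 := by positivity
  obtain ⟨m, hm, hm1, hm2⟩ : ∃ m : ℕ, m + 1 ≤ N ∧ (m : ℝ) ≤ t * N ∧ t * N ≤ m + 1 := by
    by_cases h : t = 1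
    · refine ⟨N - 1, by omega, ?_, ?_⟩
      · rw [h]; push_cast [Nat.cast_sub hN]; linarith
      · rw [h]; push_cast [Nat.cast_sub hN]; linarith
    · have htN : t * N < N := by
        have : t < 1 := lt_of_le_of_ne ht1 h
        nlinarith
      refine ⟨⌊t * N⌋₊, ?_, Nat.floor_le (by positivity), (Nat.lt_floor_add_one _).le⟩
      have := (Nat.floor_lt (by positivity : 0 ≤ t * N)).mpr htN
      omega
  have key : 1 / 64 * ∑ p ∈ B, (σ * (q p - x p) - q p / 16) * (t - τ p) ^ 2 ≤
      (1 - (t * N - m)) * (F (some m) / 2) + (t * N - m) * (F (some (m + 1)) / 2)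
        + F none / 2 := by
    simp only [hF, Finset.mul_sum, Finset.sum_div, ← Finset.sum_add_distrib]
    apply Finset.sum_le_sum
    intro p _
    simp only [eU, eV]
    push_cast
    obtain ⟨s, hs⟩ : ∃ s, s = t * N - m := ⟨_, rfl⟩
    rw [← hs]
    have ht : t = (m + s) / N := by rw [hs]; field_simp; ring
    have hs0 : 0 ≤ s := by linarith
    have hs1 : s ≤ 1 := by linarith
    have hss : 0 ≤ s * (1 - s) := mul_nonneg hs0 (by linarith)
    have hss1 : s * (1 - s) ≤ 1 := by nlinarith
    have e1 : (t - τ p) ^ 2 = (1 - s) * ((m : ℝ) / N - τ p) ^ 2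
        + s * (((m : ℝ) + 1) / N - τ p) ^ 2 - s * (1 - s) / (N : ℝ) ^ 2 := by
      rw [ht]; field_simp; ring
    rw [e1]
    have hκ : -(σ * (q p - x p) - q p / 16) ≤ x p + 2 * q p := by
      have := abs_le.mp hσ
      nlinarith [hq p, hx p]
    have h2 : -(σ * (q p - x p) - q p / 16) * (s * (1 - s)) ≤ x p + 2 * q p := by
      have := mul_le_mul_of_nonneg_right hκ hss
      have h3 : 0 ≤ x p + 2 * q p := by linarith [hq p, hx p]
      nlinarith
    have h4 : -(σ * (q p - x p) - q p / 16) * (s * (1 - s)) / (N : ℝ) ^ 2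
        ≤ (x p + 2 * q p) / (N : ℝ) ^ 2 := by gcongr
    have e2 : (1 / 32 / (N : ℝ) ^ 2 * x p + 1 / 16 / (N : ℝ) ^ 2 * q p) =
        1 / 32 * ((x p + 2 * q p) / (N : ℝ) ^ 2) := by ring
    rw [e2]
    have e3 : -(σ * (q p - x p) - q p / 16) * (s * (1 - s)) / (N : ℝ) ^ 2 =
      -(σ * (q p - x p) - q p / 16) * (s * (1 - s) / (N : ℝ) ^ 2) := by ring
    rw [e3] at h4
    linarith
  have hmem : ∀ o ∈ Finset.insertNone (Finset.range (N + 1)),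
      1 / 64 * ∑ p ∈ B, (σ * (q p - x p) - q p / 16) * (t - τ p) ^ 2 ≤ F o →
      Real.exp (1 / 64 * ∑ p ∈ B, (σ * (q p - x p) - q p / 16) * (t - τ p) ^ 2) ≤
      ∑ o ∈ Finset.insertNone (Finset.range (N + 1)), Real.exp (F o) := by
    intro o ho h
    refine (Real.exp_le_exp.mpr h).trans ?_
    exact Finset.single_le_sum (f := fun o => Real.exp (F o)) (fun _ _ => (Real.exp_pos _).le) ho
  by_contra hcon
  have n0 := mt (hmem none (by simp)) hcon
  have n1 := mt (hmem (some m) (by simp; omega)) hcon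
  have n2 := mt (hmem (some (m+1)) (by simp; omega)) hcon
  push Not at n0 n1 n2
  have hs0 : 0 ≤ t * N - m := by linarith
  have hs1 : 0 ≤ 1 - (t * N - m) := by linarith
  have a1 := mul_le_mul_of_nonneg_left n1.le hs1
  have a2 := mul_le_mul_of_nonneg_left n2.le hs0
  nlinarith

lemma aux_expo (σ : ℝ) (hσ : |σ| ≤ 1) (N : ℕ) (hN : 1 ≤ N) (τ q : ℝ) (hq : 0 ≤ q)
    (m : ℕ) (hm : m ≤ N) (hτ0 : 0 ≤ τ) (hτ1 : τ ≤ 1) :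
    q * (Real.exp (eU σ N τ (some m)) - 1) + eV σ N τ q (some m) ≤
      -(1 / 1024) * (q * ((m : ℝ) / N - τ) ^ 2) := by
  simp only [eU, eV]
  have hNr : (1 : ℝ) ≤ N := by exact_mod_cast hN
  have h0 : 0 ≤ (m : ℝ) / N := by positivity
  have h1 : (m : ℝ) / N ≤ 1 := by
    rw [div_le_one (by positivity)]; exact_mod_cast hm
  obtain ⟨d, hd⟩ : ∃ d, d = ((m : ℝ) / N - τ) ^ 2 := ⟨_, rfl⟩
  have hd0 : 0 ≤ d := by rw [hd]; positivity
  have hd1 : d ≤ 1 := by rw [hd, sq_le_one_iff_abs_le_one, abs_le]; constructor <;> linarith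
  rw [← hd]
  have hσ2 : σ ^ 2 ≤ 1 := (sq_le_one_iff_abs_le_one σ).mpr hσ
  have hu : |-(1 / 32) * σ * d| ≤ 1 := by
    rw [abs_mul, abs_mul, abs_of_nonneg hd0]
    norm_num
    nlinarith [abs_nonneg σ]
  have := (abs_le.mp (Real.abs_exp_sub_one_sub_id_le hu)).2
  have h3 : Real.exp (-(1 / 32) * σ * d) - 1 ≤ -(1 / 32) * σ * d + 1/1024 * d := by
    have : (-(1 / 32) * σ * d) ^ 2 ≤ 1/1024 * d := by
      have : d ^ 2 ≤ d := by nlinarith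
      nlinarith [mul_le_mul hσ2 this (by positivity) (by norm_num)]
    linarith
  have := mul_le_mul_of_nonneg_left h3 hq
  nlinarith

lemma aux_expo' (σ : ℝ) (N : ℕ) (hN : 1 ≤ N) (τ q : ℝ) (hq : 0 ≤ q) :
    q * (Real.exp (eU σ N τ none) - 1) + eV σ N τ q none ≤ q / (N : ℝ) ^ 2 := by
  simp only [eU, eV]
  have hNr : (1 : ℝ) ≤ N := by exact_mod_cast hN
  obtain ⟨d, hd⟩ : ∃ d, d = 1 / (N : ℝ) ^ 2 := ⟨_, rfl⟩
  have hd0 : 0 ≤ d := by rw [hd]; positivity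
  have hd1 : d ≤ 1 := by rw [hd, div_le_one (by positivity)]; nlinarith
  have e1 : 1 / 32 / (N : ℝ) ^ 2 = d / 32 := by rw [hd]; ring
  have e2 : 1 / 16 / (N : ℝ) ^ 2 = d / 16 := by rw [hd]; ring
  have e3 : q / (N : ℝ) ^ 2 = q * d := by rw [hd]; ring
  rw [e1, e2, e3]
  have hu : |d / 32| ≤ 1 := by rw [abs_of_nonneg (by positivity)]; linarith
  have := (abs_le.mp (Real.abs_exp_sub_one_sub_id_le hu)).2
  have h3 : Real.exp (d / 32) - 1 ≤ d / 16 := by nlinarith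
  have := mul_le_mul_of_nonneg_left h3 hq
  nlinarith [mul_nonneg hq hd0]

lemma aux_jensen {ι : Type*} (B : Finset ι) (q τ : ι → ℝ) (hq : ∀ p, 0 ≤ q p)
    (hw : 0 < ∑ p ∈ B, q p) (t : ℝ) :
    (∑ p ∈ B, q p) * (t - (∑ p ∈ B, q p * τ p) / ∑ p ∈ B, q p) ^ 2 ≤
      ∑ p ∈ B, q p * (t - τ p) ^ 2 := by
  set w := ∑ p ∈ B, q p
  set A := ∑ p ∈ B, q p * τ p
  obtain ⟨y, hy⟩ : ∃ y, y = A / w := ⟨_, rfl⟩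
  rw [← hy]
  have hA : A = y * w := by rw [hy]; field_simp
  have h1 : ∑ p ∈ B, (q p * (t - y) ^ 2 + 2 * (t - y) * (q p * y - q p * τ p)) ≤
      ∑ p ∈ B, q p * (t - τ p) ^ 2 := by
    apply Finset.sum_le_sum
    intro p _
    nlinarith [mul_nonneg (hq p) (sq_nonneg (y - τ p))]
  rw [Finset.sum_add_distrib, ← Finset.mul_sum, Finset.sum_sub_distrib, ← Finset.sum_mul,
    ← Finset.sum_mul] at h1
  change w * (t - y) ^ 2 + 2 * (t - y) * (w * y - A) ≤ _ at h1
  rw [hA] at h1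
  linarith

def bN {ι : Type*} (B : Finset ι) (q : ι → ℝ) : ℕ := ⌊Real.sqrt (∑ p ∈ B, q p)⌋₊ + 1

lemma aux_blocksum : ∃ K : ℝ, 1 ≤ K ∧ ∀ {ι : Type} (B : Finset ι) (q τ : ι → ℝ)
    (_ : ∀ p, 0 ≤ q p) (_ : ∀ p, 0 ≤ τ p) (_ : ∀ p, τ p ≤ 1) (σ : ℝ) (_ : |σ| ≤ 1),
      ∑ o ∈ Finset.insertNone (Finset.range (bN B q + 1)),
        Real.exp (∑ p ∈ B, (q p * (Real.exp (eU σ (bN B q) (τ p) o) - 1)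
          + eV σ (bN B q) (τ p) (q p) o)) ≤ K := by
  obtain ⟨K, hK, hg⟩ := aux_gauss
  refine ⟨K + 5, by linarith, ?_⟩
  intro ι B q τ hq hτ0 hτ1 σ hσ
  set N := bN B q with hNdef
  have hN : 1 ≤ N := by simp [hNdef, bN]
  have hNr : (1 : ℝ) ≤ N := by exact_mod_cast hN
  set w := ∑ p ∈ B, q p with hw
  have hw0 : 0 ≤ w := Finset.sum_nonneg fun p _ => hq p
  have hwN : w ≤ (N : ℝ) ^ 2 := by
    have : Real.sqrt w ≤ N := by
      rw [hNdef, bN]; push_cast; exact (Nat.lt_floor_add_one _).le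
    calc w = Real.sqrt w ^ 2 := (Real.sq_sqrt hw0).symm
      _ ≤ _ := by gcongr
  rw [Finset.sum_insertNone]
  have hnone : Real.exp (∑ p ∈ B, (q p * (Real.exp (eU σ N (τ p) none) - 1)
          + eV σ N (τ p) (q p) none)) ≤ 3 := by
    have : ∑ p ∈ B, (q p * (Real.exp (eU σ N (τ p) none) - 1)
          + eV σ N (τ p) (q p) none) ≤ 1 := by
      calc _ ≤ ∑ p ∈ B, q p / (N : ℝ) ^ 2 :=
            Finset.sum_le_sum fun p _ => aux_expo' σ N hN (τ p) (q p) (hq p)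
        _ = w / (N : ℝ) ^ 2 := by rw [← Finset.sum_div]
        _ ≤ 1 := by rw [div_le_one (by positivity)]; exact hwN
    exact (Real.exp_le_exp.mpr this).trans Real.exp_one_lt_three.le
  have hsome : ∀ m ∈ Finset.range (N + 1),
      Real.exp (∑ p ∈ B, (q p * (Real.exp (eU σ N (τ p) (some m)) - 1)
          + eV σ N (τ p) (q p) (some m))) ≤
      Real.exp (-(1/1024) * ∑ p ∈ B, q p * ((m : ℝ) / N - τ p) ^ 2) := by
    intro m hm
    apply Real.exp_le_exp.mpr
    rw [Finset.mul_sum]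
    apply Finset.sum_le_sum
    intro p _
    exact aux_expo σ hσ N hN (τ p) (q p) (hq p) m (by simp at hm; omega) (hτ0 p) (hτ1 p)
  have hS : ∑ m ∈ Finset.range (N + 1),
      Real.exp (-(1/1024) * ∑ p ∈ B, q p * ((m : ℝ) / N - τ p) ^ 2) ≤ K + 2 := by
    by_cases h1 : w < 1
    · have hN1 : N = 1 := by
        rw [hNdef, bN, ← hw]
        have : Real.sqrt w < 1 := by rw [Real.sqrt_lt' one_pos]; simpa using h1
        simp [Nat.floor_eq_zero, this]
      have : ∀ m ∈ Finset.range (N + 1),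
        Real.exp (-(1/1024) * ∑ p ∈ B, q p * ((m : ℝ) / N - τ p) ^ 2) ≤ 1 := by
        intro m _
        rw [Real.exp_le_one_iff]
        have : 0 ≤ ∑ p ∈ B, q p * ((m : ℝ) / N - τ p) ^ 2 :=
          Finset.sum_nonneg fun p _ => mul_nonneg (hq p) (sq_nonneg _)
        linarith
      have h2 := Finset.sum_le_sum this
      rw [Finset.sum_const, Finset.card_range, hN1] at h2
      rw [hN1]
      norm_num at h2 ⊢
      linarith
    · push Not at h1
      have hNw : (N : ℝ) ^ 2 ≤ 4 * w := by
        have h1' : 1 ≤ Real.sqrt w := Real.one_le_sqrt.mpr h1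
        have : (N : ℝ) ≤ 2 * Real.sqrt w := by
          rw [hNdef, bN]; push_cast
          have := Nat.floor_le (Real.sqrt_nonneg w)
          linarith
        calc (N : ℝ) ^ 2 ≤ (2 * Real.sqrt w) ^ 2 := by gcongr
          _ = 4 * w := by rw [mul_pow, Real.sq_sqrt hw0]; norm_num
      set y := (∑ p ∈ B, q p * τ p) / ∑ p ∈ B, q p with hy
      refine le_trans (Finset.sum_le_sum (g := fun m : ℕ =>
        Real.exp (-(1/4096) * ((m : ℝ) - N * y) ^ 2)) ?_) ((hg (N * y) (N + 1)).trans (by linarith))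
      intro m _
      apply Real.exp_le_exp.mpr
      have hj := aux_jensen B q τ hq (by rw [← hw]; linarith) ((m : ℝ) / N)
      rw [← hy, ← hw] at hj
      have e : ((m : ℝ) - N * y) ^ 2 = (N : ℝ) ^ 2 * ((m : ℝ) / N - y) ^ 2 := by
        field_simp
      have := mul_le_mul_of_nonneg_right hNw (sq_nonneg ((m : ℝ) / N - y))
      rw [← e] at this
      linarith
  have := Finset.sum_le_sum hsome
  linarith

lemma aux_mgf {Ω ι : Type} [MeasurableSpace Ω] [Fintype ι] (μ : Measure Ω)
    [IsProbabilityMeasure μ] (X : ι → Ω → ℝ) (q : ι → ℝ) (hq : ∀ p, 0 ≤ q p)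
    (hXm : ∀ p, Measurable (X p)) (hX01 : ∀ p ω, X p ω = 0 ∨ X p ω = 1)
    (hXq : ∀ p, μ {ω | X p ω = 1} = ENNReal.ofReal (q p)) (hind : iIndepFun X μ)
    (u v : ι → ℝ) :
    ∫ ω, Real.exp (∑ p, (u p * X p ω + v p)) ∂μ ≤
      Real.exp (∑ p, (q p * (Real.exp (u p) - 1) + v p)) := by
  have hint : ∀ p, ∫ ω, X p ω ∂μ = q p := by
    intro p
    have : X p = ({ω | X p ω = 1} : Set Ω).indicator 1 := by
      funext ω
      rcases hX01 p ω with h | h <;> simp [Set.indicator, h]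
    have hms : MeasurableSet {ω | X p ω = 1} := hXm p (measurableSet_singleton 1)
    rw [this, integral_indicator_one hms, Measure.real, hXq,
      ENNReal.toReal_ofReal (hq p)]
  have hintg : ∀ p, Integrable (X p) μ := by
    intro p
    apply Integrable.of_bound (hXm p).aestronglyMeasurable 1
    filter_upwards with ω
    rcases hX01 p ω with h | h <;> simp [h]
  simp_rw [Real.exp_sum]
  rw [hind.integral_fun_prod_comp (f := fun p x => Real.exp (u p * x + v p))
    (fun p => (hXm p).aemeasurable) (fun p => by
      apply Measurable.aestronglyMeasurable; fun_prop)]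
  apply Finset.prod_le_prod
  · intro p _
    exact integral_nonneg fun ω => (Real.exp_pos _).le
  · intro p _
    have e : ∀ ω, Real.exp (u p * X p ω + v p) =
        (1 + (Real.exp (u p) - 1) * X p ω) * Real.exp (v p) := by
      intro ω
      rw [Real.exp_add]
      rcases hX01 p ω with h | h <;> simp [h]
    simp_rw [e]
    rw [integral_mul_const, integral_add (integrable_const _) ((hintg p).const_mul _),
      integral_const_mul, hint, Real.exp_add]
    apply mul_le_mul_of_nonneg_right _ (Real.exp_pos _).le
    simp
    have := Real.add_one_le_exp (q p * (Real.exp (u p) - 1))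
    linarith

lemma aux_prod {Ω ι β α : Type} [MeasurableSpace Ω] [Fintype ι] [Fintype β] [DecidableEq β]
    (μ : Measure Ω)
    [IsProbabilityMeasure μ] (X : ι → Ω → ℝ) (q : ι → ℝ) (hq : ∀ p, 0 ≤ q p)
    (hXm : ∀ p, Measurable (X p)) (hX01 : ∀ p ω, X p ω = 0 ∨ X p ω = 1)
    (hXq : ∀ p, μ {ω | X p ω = 1} = ENNReal.ofReal (q p)) (hind : iIndepFun X μ)
    (blk : ι → β) (S : β → Finset α) (u v : β → α → ι → ℝ) :
    Integrable (fun ω => ∏ b, ∑ o ∈ S b,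
      Real.exp (∑ p with blk p = b, (u b o p * X p ω + v b o p))) μ ∧
    ∫ ω, ∏ b, ∑ o ∈ S b, Real.exp (∑ p with blk p = b, (u b o p * X p ω + v b o p)) ∂μ ≤
      ∏ b, ∑ o ∈ S b,
        Real.exp (∑ p with blk p = b, (q p * (Real.exp (u b o p) - 1) + v b o p)) := by
  have hfib : ∀ (M : β → α) (f : β → α → ι → ℝ),
      ∏ b, Real.exp (∑ p with blk p = b, f b (M b) p) =
        Real.exp (∑ p, f (blk p) (M (blk p)) p) := by
    intro M f
    rw [← Real.exp_sum, ← Finset.sum_fiberwise Finset.univ blk]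
    congr 1
    apply Finset.sum_congr rfl
    intro b _
    apply Finset.sum_congr rfl
    intro p hp
    rw [(Finset.mem_filter.mp hp).2]
  simp_rw [Finset.prod_univ_sum]
  have hi : ∀ M : β → α, Integrable (fun ω => ∏ b,
      Real.exp (∑ p with blk p = b, (u b (M b) p * X p ω + v b (M b) p))) μ := by
    intro M
    have e : ∀ ω, ∏ b, Real.exp (∑ p with blk p = b, (u b (M b) p * X p ω + v b (M b) p)) =
        Real.exp (∑ p, (u (blk p) (M (blk p)) p * X p ω + v (blk p) (M (blk p)) p)) :=
      fun ω => hfib M (fun b o p => u b o p * X p ω + v b o p)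
    simp_rw [e]
    apply Integrable.of_bound (C := Real.exp (∑ p,
      (|u (blk p) (M (blk p)) p| + v (blk p) (M (blk p)) p)))
    · apply Measurable.aestronglyMeasurable
      fun_prop
    · filter_upwards with ω
      rw [Real.norm_eq_abs, Real.abs_exp]
      apply Real.exp_le_exp.mpr
      apply Finset.sum_le_sum
      intro p _
      have := le_abs_self (u (blk p) (M (blk p)) p)
      have := abs_nonneg (u (blk p) (M (blk p)) p)
      rcases hX01 p ω with h | h <;> rw [h] <;> linarith
  refine ⟨integrable_finsetSum _ fun M _ => hi M, ?_⟩
  rw [integral_finsetSum _ fun M _ => hi M]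
  apply Finset.sum_le_sum
  intro M _
  have e : ∀ ω, ∏ b, Real.exp (∑ p with blk p = b, (u b (M b) p * X p ω + v b (M b) p)) =
        Real.exp (∑ p, (u (blk p) (M (blk p)) p * X p ω + v (blk p) (M (blk p)) p)) :=
      fun ω => hfib M (fun b o p => u b o p * X p ω + v b o p)
  simp_rw [e]
  rw [hfib M (fun b o p => q p * (Real.exp (u b o p) - 1) + v b o p)]
  exact aux_mgf μ X q hq hXm hX01 hXq hind _ _

lemma aux_tail : ∃ K : ℝ, 1 ≤ K ∧ ∀ {Ω ι β : Type} [MeasurableSpace Ω] [Fintype ι] [Fintype β]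
    [DecidableEq β] (μ : Measure Ω) [IsProbabilityMeasure μ] (X : ι → Ω → ℝ) (q : ι → ℝ)
    (_ : ∀ p, 0 ≤ q p)
    (_ : ∀ p, Measurable (X p)) (_ : ∀ p ω, X p ω = 0 ∨ X p ω = 1)
    (_ : ∀ p, μ {ω | X p ω = 1} = ENNReal.ofReal (q p)) (_ : iIndepFun X μ)
    (blk : ι → β) (τ : ι → ℝ) (_ : ∀ p, 0 ≤ τ p) (_ : ∀ p, τ p ≤ 1) (σ : ℝ) (_ : |σ| ≤ 1)
    (S : ℝ),
    μ {ω | ∃ t : β → ℝ, (∀ b, 0 ≤ t b ∧ t b ≤ 1) ∧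
      S / 16 ≤ ∑ p, (σ * (q p - X p ω) - q p / 16) * (t (blk p) - τ p) ^ 2} ≤
    ENNReal.ofReal (K ^ Fintype.card β * Real.exp (-(S / 1024))) := by
  obtain ⟨K, hK, hb⟩ := aux_blocksum
  refine ⟨K, hK, ?_⟩
  intro Ω ι β _ _ _ _ μ _ X q hq hXm hX01 hXq hind blk τ hτ0 hτ1 σ hσ S
  let B : β → Finset ι := fun b => Finset.univ.filter fun p => blk p = b
  let W : Ω → ℝ := fun ω => ∏ b, ∑ o ∈ Finset.insertNone (Finset.range (bN (B b) q + 1)),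
    Real.exp (∑ p with blk p = b, (eU σ (bN (B b) q) (τ p) o * X p ω
      + eV σ (bN (B b) q) (τ p) (q p) o))
  obtain ⟨hI, hE⟩ := aux_prod μ X q hq hXm hX01 hXq hind blk
    (fun b => Finset.insertNone (Finset.range (bN (B b) q + 1)))
    (fun b o p => eU σ (bN (B b) q) (τ p) o) (fun b o p => eV σ (bN (B b) q) (τ p) (q p) o)
  have hE2 : ∫ ω, W ω ∂μ ≤ K ^ Fintype.card β := by
    refine hE.trans ?_
    rw [← Finset.card_univ, ← Finset.prod_const]
    apply Finset.prod_le_prod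
    · intro b _
      exact Finset.sum_nonneg fun _ _ => (Real.exp_pos _).le
    · intro b _
      exact hb (B b) q τ hq hτ0 hτ1 σ hσ
  have hsub : {ω | ∃ t : β → ℝ, (∀ b, 0 ≤ t b ∧ t b ≤ 1) ∧
      S / 16 ≤ ∑ p, (σ * (q p - X p ω) - q p / 16) * (t (blk p) - τ p) ^ 2} ⊆
      {ω | Real.exp (S / 1024) ≤ W ω} := by
    rintro ω ⟨t, ht, h⟩
    have hX0 : ∀ p, 0 ≤ X p ω := fun p => by rcases hX01 p ω with h | h <;> simp [h]
    have h1 : Real.exp (S / 1024) ≤ Real.exp (1 / 64 *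
        ∑ p, (σ * (q p - X p ω) - q p / 16) * (t (blk p) - τ p) ^ 2) := by
      apply Real.exp_le_exp.mpr; linarith
    refine h1.trans ?_
    rw [← Finset.sum_fiberwise Finset.univ blk, Finset.mul_sum, Real.exp_sum]
    apply Finset.prod_le_prod
    · intro b _; exact (Real.exp_pos _).le
    · intro b _
      have e : ∑ p with blk p = b, (σ * (q p - X p ω) - q p / 16) * (t (blk p) - τ p) ^ 2 =
          ∑ p with blk p = b, (σ * (q p - X p ω) - q p / 16) * (t b - τ p) ^ 2 := by
        apply Finset.sum_congr rfl
        intro p hp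
        rw [(Finset.mem_filter.mp hp).2]
      rw [e]
      exact aux_block (B b) q (fun p => X p ω) τ hq hX0 σ hσ (bN (B b) q) (by simp [bN]) (t b)
        (ht b).1 (ht b).2
  refine (measure_mono hsub).trans ?_
  have hW0 : 0 ≤ᵐ[μ] W := by
    filter_upwards with ω
    exact Finset.prod_nonneg fun _ _ => Finset.sum_nonneg fun _ _ => (Real.exp_pos _).le
  have hm := mul_meas_ge_le_integral_of_nonneg hW0 hI (Real.exp (S / 1024))
  rw [← ofReal_measureReal]
  apply ENNReal.ofReal_le_ofReal
  rw [Real.exp_neg, ← div_eq_mul_inv, le_div_iff₀ (Real.exp_pos _), mul_comm]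
  exact hm.trans hE2

lemma aux_pairSum {n : ℕ} (f : Fin n → Fin n → ℝ) :
    pairSum f = ∑ p : {p : Fin n × Fin n // p.1 < p.2}, f p.1.1 p.1.2 := by
  unfold pairSum
  rw [← Fintype.sum_prod_type' (f := fun i j => if i < j then f i j else 0), ← Finset.sum_filter]
  exact Finset.sum_subtype _ (by simp) (fun x : Fin n × Fin n => f x.1 x.2)

lemma aux_supNorm {n : ℕ} (M : Fin n → Fin n → ℝ) (i j : Fin n) : |M i j| ≤ supNorm M := by
  unfold supNorm
  exact (le_ciSup (f := fun j => |M i j|) (Set.finite_range _).bddAbove j).trans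
    (le_ciSup (f := fun i => ⨆ j, |M i j|) (Set.finite_range _).bddAbove i)

theorem stmt_13 :
    ∃ c₀ : ℝ, 0 < c₀ ∧ ∃ C : ℝ, 0 < C ∧
      ∀ (n : ℕ), 2 ≤ n → ∀ (k : ℕ), 1 ≤ k →
      ∀ (γ ρ : ℝ), 0 < γ → γ ≤ ρ → ρ < 1 → γ ≤ 1 - ρ →
      ∀ (Ω : Type) [MeasurableSpace Ω] (μ : Measure Ω), IsProbabilityMeasure μ →
      ∀ (Θtil Pmat : Fin n → Fin n → ℝ) (X : Ω → Fin n → Fin n → ℝ),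
        -- Π symmetric with entries in [0,1]; X the Bernoulli(Π) sampling matrix
        (∀ i j, Pmat i j = Pmat j i) → (∀ i j, Pmat i j ∈ Set.Icc (0 : ℝ) 1) →
        IsBernoulliMatrix μ X Pmat →
        -- Θ̃ symmetric, zero diagonal, off-diagonal entries in [γ, ρ]
        (∀ i j, Θtil i j = Θtil j i) → (∀ i, Θtil i i = 0) →
        (∀ i j : Fin n, i < j → Θtil i j ∈ Set.Icc γ ρ) →
        ∀ T : ℝ, 2 * (c₀ * ρ * (ρ ^ 2 / γ ^ 2) * (n * Real.log k + (k : ℝ) ^ 2)) ≤ T →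
          μ {ω | T / 4 ≤ ZT n k γ ρ T Pmat Θtil X ω} ≤
            ENNReal.ofReal (Real.exp (-(C * T / ρ))) := by
  obtain ⟨K, hK, htail⟩ := aux_tail
  have hlK : 0 ≤ Real.log K := Real.log_nonneg hK
  refine ⟨1024 * (2 + Real.log K), by positivity, 1 / 2048, by norm_num, ?_⟩
  intro n hn k hk γ ρ hγ hγρ hρ1 _ Ω _ μ _ Θtil Pmat X hPs hP hX hΘs hΘ0 hΘ T hT
  obtain ⟨hXm, hXs, hXd, hX01, hXP, hind⟩ := hX
  have hρ : 0 < ρ := hγ.trans_le hγρ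
  have hk1 : (1 : ℝ) ≤ k := by exact_mod_cast hk
  have hlk : 0 ≤ Real.log k := Real.log_nonneg hk1
  have hnk : 0 ≤ (n : ℝ) * Real.log k := by positivity
  have hk2 : (1 : ℝ) ≤ (k : ℝ) ^ 2 := by nlinarith
  have hratio : 1 ≤ ρ ^ 2 / γ ^ 2 := by
    rw [one_le_div (by positivity)]; gcongr
  -- lower bound on T / ρ
  have hTρ : Real.log 2 + n * Real.log k + (k : ℝ) ^ 2 * Real.log K ≤ 1 / 2048 * T / ρ := by
    have h1 : 2048 * (2 + Real.log K) * (n * Real.log k + (k : ℝ) ^ 2) ≤ T / ρ := by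
      rw [le_div_iff₀ hρ]
      refine le_trans ?_ hT
      have : 0 ≤ (2 + Real.log K) * (n * Real.log k + (k : ℝ) ^ 2) * ρ := by positivity
      nlinarith [mul_le_mul_of_nonneg_left hratio this]
    have hl2 : Real.log 2 ≤ 1 := by linarith [Real.log_two_lt_d9]
    have e : 1 / 2048 * T / ρ = 1 / 2048 * (T / ρ) := by ring
    rw [e]
    nlinarith [mul_nonneg hlK hnk]
  have hl2 : 0 < Real.log 2 := Real.log_pos (by norm_num)
  have hTpos : 0 < T := by
    have h : 0 < 1 / 2048 * T / ρ :=
      lt_of_lt_of_le (by nlinarith [mul_nonneg (sq_nonneg (k : ℝ)) hlK]) hTρ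
    have h2 : 0 < 1 / 2048 * T := by
      by_contra hc
      push Not at hc
      have := div_nonpos_of_nonpos_of_nonneg hc hρ.le
      linarith
    linarith
  let ι := {p : Fin n × Fin n // p.1 < p.2}
  let q : ι → ℝ := fun p => Pmat p.1.1 p.1.2
  let Y : ι → Ω → ℝ := fun p ω => X ω p.1.1 p.1.2
  let τ : ι → ℝ := fun p => Θtil p.1.1 p.1.2 / ρ
  let blk : (Fin n → Fin k) → ι → Fin k × Fin k := fun z p => (z p.1.1, z p.1.2)
  let E : (Fin n → Fin k) → ℝ → Set Ω := fun z σ => {ω | ∃ t : Fin k × Fin k → ℝ,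
      (∀ b, 0 ≤ t b ∧ t b ≤ 1) ∧
      (T / ρ ^ 2) / 16 ≤ ∑ p, (σ * (q p - Y p ω) - q p / 16) * (t (blk z p) - τ p) ^ 2}
  have hE : ∀ z σ, |σ| ≤ 1 → μ (E z σ) ≤
      ENNReal.ofReal (K ^ (k * k) * Real.exp (-(T / ρ ^ 2 / 1024))) := by
    intro z σ hσ
    have := htail μ Y q (fun p => (hP _ _).1) (fun p => hXm _ _) (fun p ω => hX01 ω _ _)
      (fun p => hXP _ _ p.2) hind (blk z) τ
      (fun p => div_nonneg (hγ.le.trans (hΘ _ _ p.2).1) hρ.le)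
      (fun p => (div_le_one hρ).mpr (hΘ _ _ p.2).2) σ hσ (T / ρ ^ 2)
    rw [Fintype.card_prod, Fintype.card_fin] at this
    exact this
  have hsub : {ω | T / 4 ≤ ZT n k γ ρ T Pmat Θtil X ω} ⊆ ⋃ z, (E z 1 ∪ E z (-1)) := by
    intro ω hω
    have hω' : T / 8 < ZT n k γ ρ T Pmat Θtil X ω := lt_of_lt_of_le (by linarith) hω
    unfold ZT at hω'
    have hne : Nonempty {Θ : Fin n → Fin n → ℝ // IsBlockConst n k Θ ∧ supNorm Θ ≤ ρ ∧
      (∀ i j : Fin n, i < j → γ ≤ Θ i j) ∧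
      wNormSq Pmat (fun i j => Θ i j - Θtil i j) ≤ T} := by
      by_contra hemp
      rw [not_nonempty_iff] at hemp
      rw [Real.iSup_of_isEmpty] at hω'
      linarith
    obtain ⟨⟨Θ, ⟨hd, z, Q, hQs, hQ⟩, hsup, hlow, hTn⟩, hgt⟩ := exists_lt_of_lt_ciSup hω'
    simp only [wNormSq, aux_pairSum] at hgt hTn
    let t : Fin k × Fin k → ℝ := fun b => max 0 (min (Q b.1 b.2 / ρ) 1)
    have ht : ∀ b, 0 ≤ t b ∧ t b ≤ 1 := fun b =>
      ⟨le_max_left _ _, max_le zero_le_one (min_le_right _ _)⟩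
    have htΘ : ∀ p : ι, t (blk z p) = Θ p.1.1 p.1.2 / ρ := by
      intro p
      have h1 : Q (z p.1.1) (z p.1.2) = Θ p.1.1 p.1.2 := (hQ _ _ p.2.ne).symm
      have h2 : Θ p.1.1 p.1.2 ≤ ρ := (le_abs_self _).trans ((aux_supNorm Θ _ _).trans hsup)
      have h3 : 0 ≤ Θ p.1.1 p.1.2 := hγ.le.trans (hlow _ _ p.2)
      simp only [t, blk, h1]
      rw [min_eq_left ((div_le_one hρ).mpr h2), max_eq_right (div_nonneg h3 hρ.le)]
    have hsum : ∀ σ : ℝ, ∑ p, (σ * (q p - Y p ω) - q p / 16) * (t (blk z p) - τ p) ^ 2 =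
        (σ * (∑ p : ι, Pmat p.1.1 p.1.2 * (Θ p.1.1 p.1.2 - Θtil p.1.1 p.1.2) ^ 2
          - ∑ p : ι, X ω p.1.1 p.1.2 * (Θ p.1.1 p.1.2 - Θtil p.1.1 p.1.2) ^ 2)
          - (∑ p : ι, Pmat p.1.1 p.1.2 * (Θ p.1.1 p.1.2 - Θtil p.1.1 p.1.2) ^ 2) / 16) / ρ ^ 2 := by
      intro σ
      rw [← Finset.sum_sub_distrib, Finset.mul_sum, Finset.sum_div, ← Finset.sum_sub_distrib,
        Finset.sum_div]
      apply Finset.sum_congr rfl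
      intro p _
      rw [htΘ p]
      simp only [q, Y, τ]
      field_simp
    have hfin : ∀ σ : ℝ, T / 8 < σ *
        (∑ p : ι, Pmat p.1.1 p.1.2 * (Θ p.1.1 p.1.2 - Θtil p.1.1 p.1.2) ^ 2
          - ∑ p : ι, X ω p.1.1 p.1.2 * (Θ p.1.1 p.1.2 - Θtil p.1.1 p.1.2) ^ 2) → ω ∈ E z σ := by
      intro σ h
      refine ⟨t, ht, ?_⟩
      rw [hsum, div_right_comm]
      apply div_le_div_of_nonneg_right _ (by positivity)
      linarith
    refine Set.mem_iUnion.mpr ⟨z, ?_⟩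
    rcases lt_abs.mp hgt with h | h
    · left; exact hfin 1 (by rw [one_mul]; exact h)
    · right; exact hfin (-1) (by rw [neg_one_mul]; exact h)
  set r := K ^ (k * k) * Real.exp (-(T / ρ ^ 2 / 1024)) with hr
  have hr0 : 0 ≤ r := by positivity
  calc μ {ω | T / 4 ≤ ZT n k γ ρ T Pmat Θtil X ω}
      ≤ μ (⋃ z, (E z 1 ∪ E z (-1))) := measure_mono hsub
    _ ≤ ∑ z, μ (E z 1 ∪ E z (-1)) := measure_iUnion_fintype_le _ _
    _ ≤ ∑ z : Fin n → Fin k, ENNReal.ofReal (2 * r) := by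
        apply Finset.sum_le_sum
        intro z _
        refine (measure_union_le _ _).trans ?_
        rw [two_mul, ENNReal.ofReal_add hr0 hr0]
        exact add_le_add (hE z 1 (by simp)) (hE z (-1) (by simp))
    _ = ENNReal.ofReal ((k : ℝ) ^ n * (2 * r)) := by
        rw [← ENNReal.ofReal_sum_of_nonneg (fun _ _ => by positivity)]
        simp
    _ ≤ _ := by
        apply ENNReal.ofReal_le_ofReal
        have e1 : (k : ℝ) ^ n = Real.exp (n * Real.log k) := by
          rw [Real.exp_nat_mul, Real.exp_log (by linarith)]
        have e2 : K ^ (k * k) = Real.exp ((k : ℝ) ^ 2 * Real.log K) := by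
          have : (k : ℝ) ^ 2 = ((k * k : ℕ) : ℝ) := by push_cast; ring
          rw [this, Real.exp_nat_mul, Real.exp_log (by linarith)]
        have e3 : (2 : ℝ) = Real.exp (Real.log 2) := (Real.exp_log (by norm_num)).symm
        rw [hr, e1, e2]
        nth_rewrite 1 [e3]
        rw [← Real.exp_add, ← Real.exp_add, ← Real.exp_add]
        apply Real.exp_le_exp.mpr
        have h5 : T / ρ ≤ T / ρ ^ 2 := by
          apply div_le_div_of_nonneg_left hTpos.le (by positivity)
          nlinarith
        have e : 1 / 2048 * T / ρ = 1 / 2048 * (T / ρ) := by ring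
        rw [e] at hTρ ⊢
        linarith
end
end

section
/- There exists an absolute constant C > 0 such that for every T > 0, the random variable Z_T = sup_{Θ ∈ S_Π(T)} | ‖Θ − Θ̃‖²_{2,Π} − ‖Θ − Θ̃‖²_{2,X} |, where S_Π(T) = {Θ ∈ T_k : ‖Θ‖_∞ ≤ ρ_n, Θ_{ij} ≥ γ_n for all i < j, ‖Θ − Θ̃‖²_{2,Π} ≤ T}, satisfies E[Z_T] ≤ T/16 + C·ρ_n·(ρ_n²/γ_n²)·(n·log k + k²). -/
open MeasureTheory ProbabilityTheory

noncomputable section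

lemma single_mgf {Ω : Type} [MeasurableSpace Ω] (μ : Measure Ω) [IsProbabilityMeasure μ]
    (X : Ω → ℝ) (hX : Measurable X) (h01 : ∀ ω, X ω = 0 ∨ X ω = 1) (p : ℝ) (hp : 0 ≤ p)
    (hμ : μ {ω | X ω = 1} = ENNReal.ofReal p) (s : ℝ) (hs : |s| ≤ 1) :
    ∫ ω, Real.exp (s * (p - X ω)) ∂μ ≤ Real.exp (p * s ^ 2) := by
  have hXi : X = Set.indicator {ω | X ω = 1} (fun _ => (1:ℝ)) := by
    funext ω
    rcases h01 ω with h | h <;> simp [Set.indicator, h]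
  have hm : MeasurableSet {ω | X ω = 1} := hX (measurableSet_singleton 1)
  have hint : ∫ ω, X ω ∂μ = p := by
    rw [hXi, integral_indicator hm]
    simp [Measure.real, hμ, hp]
  have hXint : Integrable X μ := by
    rw [hXi]; exact (integrable_const _).indicator hm
  have h1 : (fun ω => Real.exp (s * (p - X ω))) =
      fun ω => Real.exp (s*p) + (Real.exp (s*(p-1)) - Real.exp (s*p)) * X ω := by
    funext ω
    rcases h01 ω with h | h <;> simp [h]
  rw [h1, integral_add (integrable_const _) (hXint.const_mul _), integral_const_mul, hint]
  simp only [integral_const, probReal_univ, one_smul]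
  have h2 : Real.exp (s*(p-1)) = Real.exp (s*p) * Real.exp (-s) := by
    rw [← Real.exp_add]; ring_nf
  have h3 : Real.exp (-s) ≤ 1 - s + s^2 := by
    have := (abs_le.1 (Real.abs_exp_sub_one_sub_id_le (x := -s) (by simpa using hs))).2
    nlinarith
  have h4 : 1 + p * (Real.exp (-s) - 1) ≤ Real.exp (p * (Real.exp (-s) - 1)) := by
    have := Real.add_one_le_exp (p * (Real.exp (-s) - 1)); linarith
  calc _ = Real.exp (s*p) * (1 + p * (Real.exp (-s) - 1)) := by rw [h2]; ring
    _ ≤ Real.exp (s*p) * Real.exp (p * (Real.exp (-s) - 1)) := by gcongr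
    _ = Real.exp (s*p + p * (Real.exp (-s) - 1)) := by rw [Real.exp_add]
    _ ≤ _ := by
      apply Real.exp_le_exp.2
      nlinarith

lemma full_mgf {Ω : Type} [MeasurableSpace Ω] (μ : Measure Ω) [IsProbabilityMeasure μ]
    {ι : Type} [Fintype ι]
    (X : ι → Ω → ℝ) (hX : ∀ e, Measurable (X e)) (h01 : ∀ e ω, X e ω = 0 ∨ X e ω = 1)
    (p : ι → ℝ) (hp : ∀ e, 0 ≤ p e)
    (hμ : ∀ e, μ {ω | X e ω = 1} = ENNReal.ofReal (p e)) (hind : iIndepFun X μ)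
    (s : ι → ℝ) (hs : ∀ e, |s e| ≤ 1) :
    Integrable (fun ω => Real.exp (∑ e, s e * (p e - X e ω))) μ ∧
    ∫ ω, Real.exp (∑ e, s e * (p e - X e ω)) ∂μ ≤ Real.exp (∑ e, p e * s e ^ 2) := by
  constructor
  · refine Integrable.of_bound (C := Real.exp (∑ e, (|p e| + 1))) ?_ ?_
    · exact (Measurable.exp (by fun_prop)).aestronglyMeasurable
    · refine Filter.Eventually.of_forall fun ω => ?_
      rw [Real.norm_eq_abs, Real.abs_exp]
      apply Real.exp_le_exp.2
      apply Finset.sum_le_sum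
      intro e _
      have h1 : |p e - X e ω| ≤ |p e| + 1 := by
        refine (abs_sub _ _).trans ?_
        rcases h01 e ω with h | h <;> simp [h]
      calc _ ≤ |s e * (p e - X e ω)| := le_abs_self _
        _ = |s e| * |p e - X e ω| := abs_mul _ _
        _ ≤ 1 * (|p e| + 1) := by gcongr; exact hs e
        _ = _ := one_mul _
  · have h1 := (hind.comp (fun e x => Real.exp (s e * (p e - x))) (fun e => by fun_prop))
    have h2 := h1.integral_fun_prod_eq_prod_integral
      (fun e => ((by fun_prop : Measurable (fun x => Real.exp (s e * (p e - x)))).comp (hX e)).aestronglyMeasurable)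
    simp only [Real.exp_sum]
    refine (le_of_eq h2).trans ?_
    apply Finset.prod_le_prod
    · intro e _; exact integral_nonneg fun ω => (Real.exp_pos _).le
    · intro e _; exact single_mgf μ (X e) (hX e) (h01 e) (p e) (hp e) (hμ e) (s e) (hs e)

/-- finite nonnegative combination of exponentials -/
def Good {ι : Type} (S : Finset ι) (p : ι → ℝ) (G : (ι → ℝ) → ℝ) (K : ℝ) : Prop :=
  ∃ (τ : Type) (_ : Fintype τ) (c : τ → ℝ) (s : τ → ι → ℝ),
    (∀ t, 0 ≤ c t) ∧ (∀ t, ∀ e, |s t e| ≤ 1) ∧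
    (∀ x, G x = ∑ t, c t * Real.exp (∑ e ∈ S, s t e * (p e - x e))) ∧
    ∑ t, c t * Real.exp (∑ e ∈ S, p e * s t e ^ 2) ≤ K

lemma Good.add {ι : Type} {S : Finset ι} {p : ι → ℝ} {G G' : (ι → ℝ) → ℝ} {K K' : ℝ}
    (h : Good S p G K) (h' : Good S p G' K') : Good S p (fun x => G x + G' x) (K + K') := by
  obtain ⟨τ, _, c, s, hc, hs, hG, hK⟩ := h
  obtain ⟨τ', _, c', s', hc', hs', hG', hK'⟩ := h'
  refine ⟨τ ⊕ τ', inferInstance, Sum.elim c c', Sum.elim s s', ?_, ?_, ?_, ?_⟩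
  · rintro (t | t) <;> simp [hc, hc']
  · rintro (t | t) e <;> simp [hs, hs']
  · intro x; simp [hG, hG']
  · simp; linarith

lemma Good.single {ι : Type} {S : Finset ι} {p : ι → ℝ} (c : ℝ) (s : ι → ℝ) (K : ℝ)
    (hc : 0 ≤ c) (hs : ∀ e, |s e| ≤ 1) (hK : c * Real.exp (∑ e ∈ S, p e * s e ^ 2) ≤ K) :
    Good S p (fun x => c * Real.exp (∑ e ∈ S, s e * (p e - x e))) K :=
  ⟨Unit, inferInstance, fun _ => c, fun _ => s, fun _ => hc, fun _ => hs,
    fun x => by simp, by simpa using hK⟩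

lemma Good.sum {ι : Type} {S : Finset ι} {p : ι → ℝ} (G : ℕ → (ι → ℝ) → ℝ) (K : ℕ → ℝ) (N : ℕ)
    (h : ∀ j < N, Good S p (G j) (K j)) :
    Good S p (fun x => ∑ j ∈ Finset.range N, G j x) (∑ j ∈ Finset.range N, K j) := by
  induction N with
  | zero => exact ⟨Empty, inferInstance, fun _ => 0, fun _ _ => 0, by simp, by simp, by simp, by simp⟩
  | succ N ih =>
    simp only [Finset.sum_range_succ]
    exact (ih fun j hj => h j (by omega)).add (h N (by omega))

lemma prod_good {Ω : Type} [MeasurableSpace Ω] (μ : Measure Ω) [IsProbabilityMeasure μ]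
    {ι : Type} [Fintype ι]
    (X : ι → Ω → ℝ) (hX : ∀ e, Measurable (X e)) (h01 : ∀ e ω, X e ω = 0 ∨ X e ω = 1)
    (p : ι → ℝ) (hp : ∀ e, 0 ≤ p e)
    (hμ : ∀ e, μ {ω | X e ω = 1} = ENNReal.ofReal (p e)) (hind : iIndepFun X μ)
    {β : Type} [Fintype β] [DecidableEq β] (b : ι → β) (G : β → (ι → ℝ) → ℝ) (K : ℝ)
    (hG : ∀ a, Good (Finset.univ.filter fun e => b e = a) p (G a) K) :
    Integrable (fun ω => ∏ a, G a (fun e => X e ω)) μ ∧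
    ∫ ω, ∏ a, G a (fun e => X e ω) ∂μ ≤ K ^ (Fintype.card β) := by
  choose τ hτ c s hc hs hGe hK using hG
  have key : ∀ (f : β → ι → ℝ), ∑ a, ∑ e ∈ Finset.univ.filter (fun e => b e = a), f a e
      = ∑ e, f (b e) e := by
    intro f
    rw [← Finset.sum_fiberwise (s := Finset.univ) (g := b)]
    refine Finset.sum_congr rfl fun a _ => Finset.sum_congr rfl fun e he => ?_
    rw [(Finset.mem_filter.1 he).2]
  have h1 : ∀ ω, ∏ a, G a (fun e => X e ω) =
      ∑ t : (∀ a, τ a), (∏ a, c a (t a)) *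
        Real.exp (∑ e, s (b e) (t (b e)) e * (p e - X e ω)) := by
    intro ω
    simp only [hGe]
    rw [Finset.prod_univ_sum, Fintype.piFinset_univ]
    refine Finset.sum_congr rfl fun t _ => ?_
    rw [Finset.prod_mul_distrib, ← Real.exp_sum,
      key (fun a e => s a (t a) e * (p e - X e ω))]
  have h2 := fun t : (∀ a, τ a) => full_mgf μ X hX h01 p hp hμ hind
    (fun e => s (b e) (t (b e)) e) (fun e => hs _ _ _)
  simp only [h1]
  refine ⟨integrable_finsetSum _ fun t _ => (h2 t).1.const_mul _, ?_⟩
  rw [integral_finsetSum _ fun t _ => (h2 t).1.const_mul _]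
  simp only [integral_const_mul]
  calc _ ≤ ∑ t : (∀ a, τ a), (∏ a, c a (t a)) *
        Real.exp (∑ e, p e * s (b e) (t (b e)) e ^ 2) := by
        refine Finset.sum_le_sum fun t _ => ?_
        exact mul_le_mul_of_nonneg_left (h2 t).2 (Finset.prod_nonneg fun a _ => hc _ _)
    _ = ∏ a, ∑ t, c a t * Real.exp (∑ e ∈ Finset.univ.filter (fun e => b e = a), p e * s a t e ^ 2) := by
        rw [Finset.prod_univ_sum, Fintype.piFinset_univ]
        refine Finset.sum_congr rfl fun t _ => ?_
        rw [Finset.prod_mul_distrib, ← Real.exp_sum, key (fun a e => p e * s a (t a) e ^ 2)]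
    _ ≤ ∏ a : β, K := by
        refine Finset.prod_le_prod (fun a _ => Finset.sum_nonneg fun t _ => ?_) fun a _ => hK a
        exact mul_nonneg (hc _ _) (Real.exp_pos _).le
    _ = _ := by simp

lemma Good.mono {ι : Type} {S : Finset ι} {p : ι → ℝ} {G : (ι → ℝ) → ℝ} {K K' : ℝ}
    (h : Good S p G K) (hK' : K ≤ K') : Good S p G K' := by
  obtain ⟨τ, h1, c, s, hc, hs, hG, hK⟩ := h
  exact ⟨τ, h1, c, s, hc, hs, hG, hK.trans hK'⟩

/-- absolute constant -/
def KK : ℝ := 5 + 4 * (1 - Real.exp (-(1/65536)))⁻¹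

lemma exp_abs_le {η t : ℝ} (_hη : 0 ≤ η) (y c : ℝ) (hy : y = η * |t| + c) :
    Real.exp y ≤ Real.exp c * Real.exp (η * t) + Real.exp c * Real.exp (-(η * t)) := by
  rw [← Real.exp_add, ← Real.exp_add]
  rcases abs_cases t with h | h
  · have : Real.exp y = Real.exp (c + η * t) := by rw [hy, h.1]; ring_nf
    rw [this]; linarith [Real.exp_pos (c + -(η * t))]
  · have : Real.exp y = Real.exp (c + -(η * t)) := by rw [hy, h.1]; ring_nf
    rw [this]; linarith [Real.exp_pos (c + (η * t))]

set_option maxHeartbeats 4000000 in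
lemma block_good {ι : Type} (S : Finset ι) (p θ : ι → ℝ) (hp : ∀ e, 0 ≤ p e)
    (hθ : ∀ e, θ e ∈ Set.Icc (0:ℝ) 1) :
    ∃ G : (ι → ℝ) → ℝ, Good S p G KK ∧ ∀ x q, q ∈ Set.Icc (0:ℝ) 1 →
      Real.exp ((1/1536) * (|∑ e ∈ S, (p e - x e) * (q - θ e) ^ 2|
        - (1/16) * ∑ e ∈ S, p e * (q - θ e)^2)) ≤ G x := by
  set a := ∑ e ∈ S, p e with ha
  set m := (∑ e ∈ S, p e * θ e) / a with hm
  have ha0 : 0 ≤ a := Finset.sum_nonneg fun e _ => hp e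
  have hpθ0 : 0 ≤ ∑ e ∈ S, p e * θ e := Finset.sum_nonneg fun e _ => mul_nonneg (hp e) (hθ e).1
  have hpθ1 : ∑ e ∈ S, p e * θ e ≤ a := Finset.sum_le_sum fun e _ => by
    nlinarith [hp e, (hθ e).2]
  have hm0 : 0 ≤ m := div_nonneg hpθ0 ha0
  have hm1 : m ≤ 1 := div_le_one_of_le₀ hpθ1 ha0
  have hma : m * a = ∑ e ∈ S, p e * θ e := by
    rcases ha0.eq_or_lt with h | h
    · rw [← h]; linarith
    · rw [hm]; field_simp
  clear_value m
  set u : ι → ℝ := fun e => θ e - m with hu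
  have hu1 : ∀ e, |u e| ≤ 1 := fun e => abs_le.2 ⟨by simp only [hu]; linarith [(hθ e).1],
    by simp only [hu]; linarith [(hθ e).2]⟩
  have hu2 : ∀ e, u e ^ 2 ≤ 1 := fun e => (sq_le_one_iff_abs_le_one _).2 (hu1 e)
  set v := ∑ e ∈ S, p e * u e ^ 2 with hv
  have hv0 : 0 ≤ v := Finset.sum_nonneg fun e _ => mul_nonneg (hp e) (sq_nonneg _)
  have hva : v ≤ a := Finset.sum_le_sum fun e _ => by nlinarith [hp e, hu2 e]
  have hpu : ∑ e ∈ S, p e * u e = 0 := by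
    simp only [hu, mul_sub, Finset.sum_sub_distrib, ← Finset.sum_mul]
    rw [← hma, ← ha]; ring
  set r := Real.sqrt (a + 1) with hr
  have hr2 : r ^ 2 = a + 1 := Real.sq_sqrt (by linarith)
  have hr1 : 1 ≤ r := Real.one_le_sqrt.2 (by linarith)
  set N := ⌈r⌉₊ + 1 with hN
  have hNj : ∀ j < N, (j:ℝ) ≤ 2 * r := by
    intro j hj
    have h1 : (j:ℝ) ≤ ⌈r⌉₊ := by exact_mod_cast Nat.lt_succ_iff.1 hj
    have h2 := Nat.ceil_lt_add_one (show 0 ≤ r by linarith)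
    linarith
  -- the five kinds of terms
  have g0 : Good S p (fun x => 1 * Real.exp (∑ e ∈ S, 0 * (p e - x e))) 1 :=
    Good.single 1 (fun _ => 0) 1 (by norm_num) (by simp) (by simp)
  have g1 : ∀ σ : ℝ, σ ^ 2 = 1 → Good S p (fun x => Real.exp (-(1/512) * a / 32) *
      Real.exp (∑ e ∈ S, (σ * (1/512)) * (p e - x e))) 1 := by
    intro σ hσ
    refine Good.single _ (fun _ => σ * (1/512)) 1 (Real.exp_pos _).le ?_ ?_
    · intro e; rw [← sq_le_one_iff_abs_le_one, mul_pow, hσ]; norm_num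
    · rw [← Finset.sum_mul, ← Real.exp_add, ← ha, mul_pow, hσ, Real.exp_le_one_iff]
      nlinarith
  have g3 : ∀ σ : ℝ, σ ^ 2 = 1 → Good S p (fun x => Real.exp (-(1/512) * v / 16) *
      Real.exp (∑ e ∈ S, (σ * (1/512) * u e ^ 2) * (p e - x e))) 1 := by
    intro σ hσ
    refine Good.single _ (fun e => σ * (1/512) * u e ^ 2) 1 (Real.exp_pos _).le ?_ ?_
    · intro e
      rw [← sq_le_one_iff_abs_le_one, mul_pow, mul_pow, hσ]
      nlinarith [hu2 e, sq_nonneg (u e)]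
    · have : ∑ e ∈ S, p e * (σ * (1/512) * u e ^ 2) ^ 2 ≤ (1/512)^2 * v := by
        rw [hv, Finset.mul_sum]
        refine Finset.sum_le_sum fun e _ => ?_
        rw [mul_pow, mul_pow, hσ]
        have h1 : (u e ^ 2) ^ 2 ≤ u e ^ 2 := by nlinarith [hu2 e, sq_nonneg (u e)]
        nlinarith [mul_le_mul_of_nonneg_left h1 (hp e)]
      rw [← Real.exp_add, Real.exp_le_one_iff]
      nlinarith
  have g2 : ∀ σ : ℝ, σ ^ 2 = 1 → ∀ j < N, Good S p
      (fun x => Real.exp (-(1/512) * ((j:ℝ)^2/2 - 2) / 32) *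
      Real.exp (∑ e ∈ S, (σ * (1/512) * (2 * j / r) * u e) * (p e - x e)))
      (2 * Real.exp (-(1/65536)) ^ j) := by
    intro σ hσ j hj
    have hjr0 : 0 ≤ (j:ℝ) / r := by positivity
    have hjr : (j:ℝ) / r ≤ 2 := by rw [div_le_iff₀ (by linarith)]; exact hNj j hj
    refine Good.single _ (fun e => σ * (1/512) * (2 * j / r) * u e) _ (Real.exp_pos _).le ?_ ?_
    · intro e
      rw [← sq_le_one_iff_abs_le_one, mul_pow, mul_pow, mul_pow, hσ, mul_div_assoc, mul_pow]
      have h1 : ((j:ℝ)/r)^2 ≤ 4 := by nlinarith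
      have h2 : ((j:ℝ)/r)^2 * u e ^ 2 ≤ 4 * 1 := by
        apply mul_le_mul h1 (hu2 e) (sq_nonneg _) (by norm_num)
      nlinarith
    · have : ∑ e ∈ S, p e * (σ * (1/512) * (2 * j / r) * u e) ^ 2 ≤ 4 * (1/512)^2 * (j:ℝ)^2 := by
        calc _ = 4 * (1/512)^2 * (j:ℝ)^2 * (v / r^2) := by
              rw [hv, Finset.sum_div, Finset.mul_sum]
              refine Finset.sum_congr rfl fun e _ => ?_
              rw [mul_pow, mul_pow, mul_pow, hσ, div_pow]; ring
          _ ≤ 4 * (1/512)^2 * (j:ℝ)^2 * 1 := by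
              gcongr
              rw [div_le_one (by positivity), hr2]; linarith
          _ = _ := by ring
      have hjj : (j:ℝ) ≤ (j:ℝ)^2 := by
        exact_mod_cast Nat.le_self_pow (by norm_num) j
      have h2 : Real.exp ((1:ℝ)/8192) ≤ 2 := by
        have := Real.exp_one_lt_d9
        have h3 : Real.exp ((1:ℝ)/8192) ≤ 1 + 1/8192 + (1/8192)^2 := by
          have := (abs_le.1 (Real.abs_exp_sub_one_sub_id_le (x := (1:ℝ)/8192)
            (by rw [abs_of_nonneg] <;> norm_num))).2
          linarith
        linarith
      calc _ ≤ Real.exp (1/8192) * Real.exp (-(1/65536)) ^ j := by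
            rw [← Real.exp_add, ← Real.exp_nat_mul, ← Real.exp_add, Real.exp_le_exp]
            nlinarith
        _ ≤ _ := by gcongr
  have gs := fun σ hσ => Good.sum _ _ N (g2 σ hσ)
  have gall := ((g0.add ((g1 1 (by norm_num)).add (g1 (-1) (by norm_num)))).add
    ((g3 1 (by norm_num)).add (g3 (-1) (by norm_num)))).add
    ((gs 1 (by norm_num)).add (gs (-1) (by norm_num)))
  refine ⟨_, gall.mono ?_, ?_⟩
  · have hlt : Real.exp (-(1/65536)) < 1 := by rw [Real.exp_lt_one_iff]; norm_num
    have hgeo : ∑ j ∈ Finset.range N, 2 * Real.exp (-(1/65536)) ^ j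
        ≤ 2 * (1 - Real.exp (-(1/65536)))⁻¹ := by
      rw [← Finset.mul_sum]
      gcongr
      rw [← tsum_geometric_of_lt_one (Real.exp_pos _).le hlt]
      exact (summable_geometric_of_lt_one (Real.exp_pos _).le hlt).sum_le_tsum _
        (fun i _ => by positivity)
    rw [KK]; linarith
  · intro x q hq
    set y := q - m with hy
    have hy1 : |y| ≤ 1 := abs_le.2 ⟨by linarith [hq.1], by linarith [hq.2]⟩
    have hy2 : y ^ 2 ≤ 1 := (sq_le_one_iff_abs_le_one _).2 hy1
    set A := ∑ e ∈ S, (p e - x e) with hA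
    set B := ∑ e ∈ S, u e * (p e - x e) with hB
    set D := ∑ e ∈ S, u e ^ 2 * (p e - x e) with hD
    have e1 : ∑ e ∈ S, (p e - x e) * (q - θ e) ^ 2 = y^2 * A - 2 * y * B + D := by
      rw [hA, hB, hD, Finset.mul_sum, Finset.mul_sum, ← Finset.sum_sub_distrib,
        ← Finset.sum_add_distrib]
      refine Finset.sum_congr rfl fun e _ => ?_
      simp only [hu, hy]; ring
    have e2 : ∑ e ∈ S, p e * (q - θ e) ^ 2 = y^2 * a + v := by
      have : ∑ e ∈ S, p e * (q - θ e) ^ 2 = y^2 * a - 2 * y * (∑ e ∈ S, p e * u e) + v := by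
        rw [ha, hv, Finset.mul_sum, Finset.mul_sum, ← Finset.sum_sub_distrib,
          ← Finset.sum_add_distrib]
        refine Finset.sum_congr rfl fun e _ => ?_
        simp only [hu, hy]; ring
      rw [this, hpu]; ring
    have habs : |y^2 * A - 2 * y * B + D| ≤ y^2 * |A| + 2 * |y| * |B| + |D| := by
      refine (abs_add_le _ _).trans ?_
      refine add_le_add ((abs_sub _ _).trans (le_of_eq ?_)) le_rfl
      simp [abs_mul]
    set t1 := (1/512) * (y^2 * (|A| - a/32)) with ht1
    set t2 := (1/512) * (2 * |y| * |B| - a * y^2/32) with ht2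
    set t3 := (1/512) * |D| + (-(1/512) * v/16) with ht3
    have hle : (1/1536) * (|y^2 * A - 2 * y * B + D| - (1/16) * (y^2 * a + v)) ≤
        (t1 + t2 + t3) / 3 := by
      rw [ht1, ht2, ht3]; nlinarith
    have hexp : Real.exp ((t1 + t2 + t3)/3) ≤ Real.exp t1 + Real.exp t3 + Real.exp t2 := by
      have p1 := Real.exp_pos t1
      have p2 := Real.exp_pos t2
      have p3 := Real.exp_pos t3
      by_cases c1 : (t1 + t2 + t3)/3 ≤ t1
      · linarith [Real.exp_le_exp.2 c1]
      by_cases c2 : (t1 + t2 + t3)/3 ≤ t2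
      · linarith [Real.exp_le_exp.2 c2]
      have c3 : (t1 + t2 + t3)/3 ≤ t3 := by push Not at c1 c2; linarith
      linarith [Real.exp_le_exp.2 c3]
    rw [e1, e2]
    refine (Real.exp_le_exp.2 hle).trans (hexp.trans ?_)
    refine add_le_add (add_le_add ?_ ?_) ?_
    · have s1 : ∑ e ∈ S, (1 * (1/512)) * (p e - x e) = (1/512) * A := by
        rw [← Finset.mul_sum]; ring
      have s2 : ∑ e ∈ S, (-1 * (1/512)) * (p e - x e) = -((1/512) * A) := by
        rw [← Finset.mul_sum]; ring
      rw [s1, s2]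
      have := exp_abs_le (η := 1/512) (t := A) (by norm_num) _ (-(1/512) * a / 32) rfl
      simp only [zero_mul, Finset.sum_const_zero, Real.exp_zero, mul_one]
      by_cases c : |A| - a/32 ≤ 0
      · have : Real.exp t1 ≤ 1 := by rw [Real.exp_le_one_iff, ht1]; nlinarith [sq_nonneg y]
        have := Real.exp_pos (-(1/512) * a / 32)
        have := mul_pos this (Real.exp_pos (1/512 * A))
        have := mul_pos (Real.exp_pos (-(1/512) * a / 32)) (Real.exp_pos (-(1/512 * A)))
        linarith
      · push Not at c
        have h : Real.exp t1 ≤ Real.exp (1/512 * |A| + -(1/512) * a / 32) := by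
          rw [Real.exp_le_exp, ht1]; nlinarith
        linarith
    · have s1 : ∑ e ∈ S, (1 * (1/512) * u e ^ 2) * (p e - x e) = (1/512) * D := by
        rw [hD, Finset.mul_sum]; exact Finset.sum_congr rfl fun e _ => by ring
      have s2 : ∑ e ∈ S, (-1 * (1/512) * u e ^ 2) * (p e - x e) = -((1/512) * D) := by
        rw [hD, Finset.mul_sum, ← Finset.sum_neg_distrib]
        exact Finset.sum_congr rfl fun e _ => by ring
      rw [s1, s2]
      exact exp_abs_le (η := 1/512) (t := D) (by norm_num) _ (-(1/512) * v / 16) rfl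
    · set j := ⌈|y| * r⌉₊ with hj
      have hyr0 : 0 ≤ |y| * r := by positivity
      have hj1 : |y| * r ≤ j := Nat.le_ceil _
      have hj2 : (j:ℝ) < |y| * r + 1 := Nat.ceil_lt_add_one hyr0
      have hjN : j < N := by
        have : j ≤ ⌈r⌉₊ := Nat.ceil_mono (by nlinarith)
        omega
      rw [← Finset.sum_add_distrib]
      refine le_trans ?_ (Finset.single_le_sum (f := fun j : ℕ =>
        Real.exp (-(1/512) * ((j:ℝ)^2/2 - 2) / 32) *
          Real.exp (∑ e ∈ S, (1 * (1/512) * (2 * j / r) * u e) * (p e - x e)) +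
        Real.exp (-(1/512) * ((j:ℝ)^2/2 - 2) / 32) *
          Real.exp (∑ e ∈ S, (-1 * (1/512) * (2 * j / r) * u e) * (p e - x e)))
        (fun i _ => by positivity) (Finset.mem_range.2 hjN))
      have s1 : ∑ e ∈ S, (1 * (1/512) * (2 * j / r) * u e) * (p e - x e)
          = (1/512 * (2 * j / r)) * B := by
        rw [hB, Finset.mul_sum]; exact Finset.sum_congr rfl fun e _ => by ring
      have s2 : ∑ e ∈ S, (-1 * (1/512) * (2 * j / r) * u e) * (p e - x e)
          = -((1/512 * (2 * j / r)) * B) := by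
        rw [hB, Finset.mul_sum, ← Finset.sum_neg_distrib]
        exact Finset.sum_congr rfl fun e _ => by ring
      simp only [s1, s2]
      refine le_trans ?_ (exp_abs_le (η := 1/512 * (2 * j / r)) (t := B) (by positivity) _
        (-(1/512) * ((j:ℝ)^2/2 - 2) / 32) rfl)
      rw [Real.exp_le_exp, ht2]
      have hyj : |y| ≤ j / r := by rw [le_div_iff₀ (by linarith)]; exact hj1
      have hB0 := mul_le_mul_of_nonneg_right hyj (abs_nonneg B)
      have hsq : (|y| * r)^2 = y^2 * a + y^2 := by rw [mul_pow, sq_abs, hr2]; ring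
      have hjj : (j:ℝ)^2/2 - 1 ≤ (|y| * r)^2 := by
        rcases Nat.eq_zero_or_pos j with h | h
        · rw [h]; push_cast; nlinarith
        · have : (1:ℝ) ≤ j := by exact_mod_cast h
          nlinarith [sq_nonneg ((j:ℝ) - 2)]
      have : 2 * (j:ℝ) / r = 2 * (j / r) := by ring
      rw [this]
      nlinarith

lemma pairSum_eq {n : ℕ} (f : Fin n → Fin n → ℝ) :
    pairSum f = ∑ e : {p : Fin n × Fin n // p.1 < p.2}, f e.1.1 e.1.2 := by
  rw [pairSum, ← Fintype.sum_prod_type', ← Finset.sum_filter]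
  exact Finset.sum_subtype _ (by simp) _

lemma pointwise_bound {n k : ℕ} {γ ρ T : ℝ} (hρ : 0 < ρ) (hγ : 0 < γ)
    {Pmat Θtil : Fin n → Fin n → ℝ} {x : Fin n → Fin n → ℝ}
    (G : (Fin n → Fin k) → Fin k × Fin k → ({p : Fin n × Fin n // p.1 < p.2} → ℝ) → ℝ)
    (hG : ∀ z a x q, q ∈ Set.Icc (0:ℝ) 1 →
      Real.exp ((1/1536) * (|∑ e ∈ Finset.univ.filter (fun e : {p : Fin n × Fin n // p.1 < p.2} =>
          (z e.1.1, z e.1.2) = a), (Pmat e.1.1 e.1.2 - x e) * (q - Θtil e.1.1 e.1.2 / ρ) ^ 2|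
        - (1/16) * ∑ e ∈ Finset.univ.filter (fun e : {p : Fin n × Fin n // p.1 < p.2} =>
          (z e.1.1, z e.1.2) = a), Pmat e.1.1 e.1.2 * (q - Θtil e.1.1 e.1.2 / ρ)^2)) ≤ G z a x)
    (Θ : Fin n → Fin n → ℝ) (h1 : IsBlockConst n k Θ) (h2 : supNorm Θ ≤ ρ)
    (h3 : ∀ i j : Fin n, i < j → γ ≤ Θ i j)
    (h4 : wNormSq Pmat (fun i j => Θ i j - Θtil i j) ≤ T) :
    Real.exp ((1/1536) * ((|wNormSq Pmat (fun i j => Θ i j - Θtil i j) -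
      wNormSq x (fun i j => Θ i j - Θtil i j)| - T / 16) / ρ ^ 2)) ≤
      ∑ z, ∏ a, G z a (fun e => x e.1.1 e.1.2) := by
  obtain ⟨-, z, Q, -, hQ⟩ := h1
  have hΘ : ∀ i j : Fin n, Θ i j ≤ ρ := by
    intro i j
    refine le_trans (le_abs_self _) (le_trans ?_ h2)
    refine le_trans ?_ (le_ciSup (f := fun i => ⨆ j, |Θ i j|) (Set.finite_range _).bddAbove i)
    exact le_ciSup (f := fun j => |Θ i j|) (Set.finite_range _).bddAbove j
  have hGnn : ∀ z a x, 0 ≤ G z a x := fun z a x =>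
    (Real.exp_pos _).le.trans (hG z a x 0 ⟨le_rfl, zero_le_one⟩)
  refine le_trans ?_ (Finset.single_le_sum (f := fun z => ∏ a, G z a (fun e => x e.1.1 e.1.2))
    (fun z _ => Finset.prod_nonneg fun a _ => hGnn _ _ _) (Finset.mem_univ z))
  set b : {p : Fin n × Fin n // p.1 < p.2} → Fin k × Fin k :=
    fun e => (z e.1.1, z e.1.2) with hb
  set q : Fin k × Fin k → ℝ := fun a => max 0 (min (Q a.1 a.2 / ρ) 1) with hq
  have hqm : ∀ a, q a ∈ Set.Icc (0:ℝ) 1 := fun a =>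
    ⟨le_max_left _ _, max_le zero_le_one (min_le_right _ _)⟩
  have hqe : ∀ e : {p : Fin n × Fin n // p.1 < p.2}, Θ e.1.1 e.1.2 = ρ * q (b e) := by
    intro e
    have h5 := hQ e.1.1 e.1.2 (ne_of_lt e.2)
    have h6 : 0 ≤ Q (z e.1.1) (z e.1.2) / ρ := by
      rw [← h5]; exact div_nonneg (hγ.le.trans (h3 _ _ e.2)) hρ.le
    have h7 : Q (z e.1.1) (z e.1.2) / ρ ≤ 1 := by
      rw [← h5]; exact div_le_one_of_le₀ (hΘ _ _) hρ.le
    simp only [hq, hb]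
    rw [min_eq_left h7, max_eq_right h6, h5]
    field_simp
  have split : ∀ c : {p : Fin n × Fin n // p.1 < p.2} → ℝ,
      ∑ e, c e * (Θ e.1.1 e.1.2 - Θtil e.1.1 e.1.2) ^ 2 =
      ρ ^ 2 * ∑ a, ∑ e ∈ Finset.univ.filter (fun e => b e = a),
        c e * (q a - Θtil e.1.1 e.1.2 / ρ) ^ 2 := by
    intro c
    rw [← Finset.sum_fiberwise (s := Finset.univ) (g := b), Finset.mul_sum]
    refine Finset.sum_congr rfl fun a _ => ?_
    rw [Finset.mul_sum]
    refine Finset.sum_congr rfl fun e he => ?_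
    rw [hqe, (Finset.mem_filter.1 he).2]
    field_simp
  rw [wNormSq, pairSum_eq] at h4
  rw [wNormSq, wNormSq, pairSum_eq, pairSum_eq, ← Finset.sum_sub_distrib]
  simp only [← sub_mul]
  rw [split (fun e => Pmat e.1.1 e.1.2)] at h4
  rw [split (fun e => Pmat e.1.1 e.1.2 - x e.1.1 e.1.2)]
  have hρ2 : 0 < ρ ^ 2 := by positivity
  refine le_trans ?_ (Finset.prod_le_prod (fun a _ => (Real.exp_pos _).le)
    fun a _ => hG z a (fun e => x e.1.1 e.1.2) (q a) (hqm a))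
  rw [← Real.exp_sum, Real.exp_le_exp, ← Finset.mul_sum, Finset.sum_sub_distrib, ← Finset.mul_sum]
  refine mul_le_mul_of_nonneg_left ?_ (by norm_num)
  rw [div_le_iff₀ hρ2, abs_mul, abs_of_pos hρ2]
  have habs := Finset.abs_sum_le_sum_abs (fun a => ∑ e ∈ Finset.univ.filter (fun e => b e = a),
        (Pmat e.1.1 e.1.2 - x e.1.1 e.1.2) * (q a - Θtil e.1.1 e.1.2 / ρ) ^ 2) Finset.univ
  have := mul_le_mul_of_nonneg_left habs hρ2.le
  linarith

set_option maxHeartbeats 4000000 in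
theorem stmt_15 :
    ∃ C : ℝ, 0 < C ∧
      ∀ (n : ℕ), 2 ≤ n → ∀ (k : ℕ), 1 ≤ k →
      ∀ (γ ρ : ℝ), 0 < γ → γ ≤ ρ → ρ < 1 →
      ∀ (Ω : Type) [MeasurableSpace Ω] (μ : Measure Ω), IsProbabilityMeasure μ →
      ∀ (Θtil Pmat : Fin n → Fin n → ℝ) (X : Ω → Fin n → Fin n → ℝ),
        -- Π symmetric with entries in [0,1]; X the Bernoulli(Π) sampling matrix
        (∀ i j, Pmat i j = Pmat j i) → (∀ i j, Pmat i j ∈ Set.Icc (0 : ℝ) 1) →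
        IsBernoulliMatrix μ X Pmat →
        -- Θ̃ symmetric, zero diagonal, off-diagonal entries in [γ, ρ]
        (∀ i j, Θtil i j = Θtil j i) → (∀ i, Θtil i i = 0) →
        (∀ i j : Fin n, i < j → Θtil i j ∈ Set.Icc γ ρ) →
        ∀ T : ℝ, 0 < T →
          (∫ ω, ZT n k γ ρ T Pmat Θtil X ω ∂μ) ≤
            T / 16 + C * ρ * (ρ ^ 2 / γ ^ 2) * (n * Real.log k + (k : ℝ) ^ 2) := by
  have hlt : Real.exp (-(1/65536)) < 1 := by rw [Real.exp_lt_one_iff]; norm_num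
  have hK5 : 5 ≤ KK := by
    have : 0 ≤ (1 - Real.exp (-(1/65536)))⁻¹ := inv_nonneg.2 (by linarith)
    rw [KK]; linarith
  have hlK : 0 ≤ Real.log KK := Real.log_nonneg (by linarith)
  refine ⟨1536 * (Real.log KK + 1), by positivity, ?_⟩
  intro n hn k hk γ ρ hγ hγρ hρ1 Ω _ μ hμ Θtil Pmat X _ hP hX _ _ hΘt T hT
  obtain ⟨hXm, -, -, hX01, hXp, hXi⟩ := hX
  have hρ : 0 < ρ := hγ.trans_le hγρ
  have hblock : ∀ (z : Fin n → Fin k) (a : Fin k × Fin k),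
      ∃ G : ({p : Fin n × Fin n // p.1 < p.2} → ℝ) → ℝ,
      Good (Finset.univ.filter (fun e : {p : Fin n × Fin n // p.1 < p.2} =>
          (z e.1.1, z e.1.2) = a)) (fun e => Pmat e.1.1 e.1.2) G KK ∧
      ∀ x q, q ∈ Set.Icc (0:ℝ) 1 →
      Real.exp ((1/1536) * (|∑ e ∈ Finset.univ.filter (fun e : {p : Fin n × Fin n // p.1 < p.2} =>
          (z e.1.1, z e.1.2) = a), (Pmat e.1.1 e.1.2 - x e) * (q - Θtil e.1.1 e.1.2 / ρ) ^ 2|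
        - (1/16) * ∑ e ∈ Finset.univ.filter (fun e : {p : Fin n × Fin n // p.1 < p.2} =>
          (z e.1.1, z e.1.2) = a), Pmat e.1.1 e.1.2 * (q - Θtil e.1.1 e.1.2 / ρ)^2)) ≤ G x := by
    intro z a
    exact block_good _ (fun e : {p : Fin n × Fin n // p.1 < p.2} => Pmat e.1.1 e.1.2) (fun e : {p : Fin n × Fin n // p.1 < p.2} => Θtil e.1.1 e.1.2 / ρ)
      (fun e => (hP _ _).1)
      (fun e : {p : Fin n × Fin n // p.1 < p.2} => ⟨div_nonneg (hγ.le.trans (hΘt _ _ e.2).1) hρ.le,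
        div_le_one_of_le₀ (hΘt _ _ e.2).2 hρ.le⟩)
  choose G hGood hG using hblock
  have hprod : ∀ z, Integrable (fun ω => ∏ a, G z a (fun e => X ω e.1.1 e.1.2)) μ ∧
      ∫ ω, ∏ a, G z a (fun e => X ω e.1.1 e.1.2) ∂μ ≤ KK ^ (Fintype.card (Fin k × Fin k)) := by
    intro z
    refine prod_good μ (fun (e : {p : Fin n × Fin n // p.1 < p.2}) ω => X ω e.1.1 e.1.2)
      ?_ ?_ (fun e => Pmat e.1.1 e.1.2) ?_ ?_ hXi (fun e => (z e.1.1, z e.1.2)) (G z) KK ?_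
    · intro e; exact hXm _ _
    · intro e ω; exact hX01 _ _ _
    · intro e; exact (hP _ _).1
    · intro e; exact hXp _ _ e.2
    · intro a; exact hGood z a
  have hGnn : ∀ z a x, 0 ≤ G z a x := fun z a x =>
    (Real.exp_pos _).le.trans (hG z a x 0 ⟨le_rfl, zero_le_one⟩)
  set F : Ω → ℝ := fun ω => ∑ z, ∏ a, G z a (fun e => X ω e.1.1 e.1.2) with hF
  have hF0 : ∀ ω, 0 ≤ F ω := fun ω =>
    Finset.sum_nonneg fun z _ => Finset.prod_nonneg fun a _ => hGnn _ _ _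
  have hFint : Integrable F μ := integrable_finsetSum _ fun z _ => (hprod z).1
  set M : ℝ := (k:ℝ) ^ n * KK ^ (k ^ 2) with hM
  have hk1 : (1:ℝ) ≤ k := by exact_mod_cast hk
  have hM1 : 1 ≤ M := one_le_mul_of_one_le_of_one_le (one_le_pow₀ hk1)
    (one_le_pow₀ (by linarith))
  have hM0 : 0 < M := by linarith
  have hFM : ∫ ω, F ω ∂μ ≤ M := by
    rw [hF, integral_finsetSum _ fun z _ => (hprod z).1]
    refine (Finset.sum_le_sum fun z _ => (hprod z).2).trans ?_
    simp [hM, sq]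
  have hlogM : Real.log M = n * Real.log k + (k:ℝ)^2 * Real.log KK := by
    rw [hM, Real.log_mul (by positivity) (by positivity), Real.log_pow, Real.log_pow]
    push_cast; ring
  have hlogM0 : 0 ≤ Real.log M := Real.log_nonneg hM1
  have hlk : 0 ≤ Real.log k := Real.log_nonneg hk1
  have hpt : ∀ ω, ZT n k γ ρ T Pmat Θtil X ω ≤
      T / 16 + 1536 * ρ ^ 2 * (Real.log M + F ω / M) := by
    intro ω
    refine Real.iSup_le ?_ ?_
    · rintro ⟨Θ, h1, h2, h3, h4⟩
      have h5 := pointwise_bound hρ hγ (x := X ω) G hG Θ h1 h2 h3 h4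
      set y := (1/1536) * ((|wNormSq Pmat (fun i j => Θ i j - Θtil i j) -
        wNormSq (X ω) (fun i j => Θ i j - Θtil i j)| - T / 16) / ρ ^ 2) with hy
      have h6 : y - Real.log M ≤ F ω / M := by
        have h7 : Real.exp (y - Real.log M) ≤ F ω / M := by
          rw [Real.exp_sub, Real.exp_log hM0]; gcongr
        linarith [Real.add_one_le_exp (y - Real.log M)]
      have h8 : |wNormSq Pmat (fun i j => Θ i j - Θtil i j) -
        wNormSq (X ω) (fun i j => Θ i j - Θtil i j)| = T / 16 + 1536 * ρ ^ 2 * y := by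
        rw [hy]; field_simp; ring
      simp only
      rw [h8]
      gcongr
      linarith
    · have := hF0 ω
      positivity
  have hint : Integrable (fun ω => T / 16 + 1536 * ρ ^ 2 * (Real.log M + F ω / M)) μ :=
    (integrable_const _).add (((integrable_const _).add (hFint.div_const M)).const_mul _)
  have hle := integral_mono_of_nonneg (μ := μ)
    (Filter.Eventually.of_forall fun ω => Real.iSup_nonneg fun _ => abs_nonneg _)
    hint (Filter.Eventually.of_forall hpt)
  refine hle.trans ?_
  have hcomp : ∫ ω, (T / 16 + 1536 * ρ ^ 2 * (Real.log M + F ω / M)) ∂μ =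
      T / 16 + 1536 * ρ ^ 2 * (Real.log M + (∫ ω, F ω ∂μ) / M) := by
    have i1 : Integrable (fun ω => F ω / M) μ := hFint.div_const M
    have i2 : Integrable (fun ω => Real.log M + F ω / M) μ := (integrable_const _).add i1
    rw [integral_add (integrable_const _) (i2.const_mul _), integral_const_mul,
      integral_add (integrable_const _) i1, integral_div M F]
    simp
  rw [hcomp]
  have hFM1 : (∫ ω, F ω ∂μ) / M ≤ 1 := (div_le_one hM0).2 hFM
  have hk2 : (1:ℝ) ≤ (k:ℝ)^2 := one_le_pow₀ hk1
  have hnk : 0 ≤ n * Real.log k := by positivity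
  have hA : Real.log M + (∫ ω, F ω ∂μ) / M ≤ (Real.log KK + 1) * (n * Real.log k + (k:ℝ)^2) := by
    rw [hlogM]; nlinarith [mul_nonneg hlK hnk]
  have hB : ρ ^ 2 ≤ ρ * (ρ ^ 2 / γ ^ 2) := by
    have : 1 ≤ ρ ^ 2 / γ ^ 2 := by
      rw [one_le_div (by positivity)]; gcongr
    nlinarith
  have hR : 0 ≤ (Real.log KK + 1) * (n * Real.log k + (k:ℝ)^2) := by positivity
  have h9 : ρ ^ 2 * (Real.log M + (∫ ω, F ω ∂μ) / M) ≤
      (ρ * (ρ ^ 2 / γ ^ 2)) * ((Real.log KK + 1) * (n * Real.log k + (k:ℝ)^2)) :=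
    (mul_le_mul_of_nonneg_left hA (by positivity)).trans (mul_le_mul_of_nonneg_right hB hR)
  linarith
end
end
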